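/- arXiv:2101.00247 — 3 statements merged into one kernel-verified Lean document; each statement's English description precedes it below -/
import Mathlib

section
/- Let G be a finite group and π a set of primes. Suppose that for every prime p dividing |G|, every Sylow p-subgroup P of G, and every maximal subgroup V of P, there exists a subgroup T of G with VT = G such that T is π-separable. Then G is π-separable. -/
open scoped Pointwise

/-- A group is `π`-separable if it has a normal series each of whose factors is a
`π`-group or a `π'`-group (the order of the factor `c k.succ / c k.castSucc` is
the index `((c k.castSucc).subgroupOf (c k.succ)).index`). -/
def PiSeparable (π : Set ℕ) (G : Type*) [Group G] : Prop :=
  ∃ (n : ℕ) (c : Fin (n + 1) → Subgroup G),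
    c 0 = ⊥ ∧ c (Fin.last n) = ⊤ ∧ Monotone c ∧ (∀ k, (c k).Normal) ∧
    ∀ k : Fin n,
      (∀ p : ℕ, p.Prime → p ∣ ((c k.castSucc).subgroupOf (c k.succ)).index → p ∈ π) ∨
      (∀ p : ℕ, p.Prime → p ∣ ((c k.castSucc).subgroupOf (c k.succ)).index → p ∉ π)


namespace PiSepAux

/-- every prime divisor of `n` lies in `σ`. -/
def SNum (σ : Set ℕ) (n : ℕ) : Prop := ∀ p : ℕ, p.Prime → p ∣ n → p ∈ σ

lemma SNum.dvd {σ : Set ℕ} {m n : ℕ} (h : SNum σ n) (hd : m ∣ n) : SNum σ m :=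
  fun p hp hpm => h p hp (hpm.trans hd)

lemma SNum.mul {σ : Set ℕ} {m n : ℕ} (hm : SNum σ m) (hn : SNum σ n) : SNum σ (m * n) :=
  fun p hp hpm => (hp.dvd_mul.1 hpm).elim (hm p hp) (hn p hp)

lemma SNum.pow {σ : Set ℕ} {p k : ℕ} (hp : p.Prime) (h : p ∈ σ) : SNum σ (p ^ k) := by
  intro q hq hd
  have := (Nat.prime_dvd_prime_iff_eq hq hp).1 (hq.dvd_of_dvd_pow hd)
  exact this ▸ h

lemma SNum.eq_one {σ : Set ℕ} {m : ℕ} (h1 : SNum σ m) (h2 : SNum σᶜ m) : m = 1 := by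
  by_contra h
  obtain ⟨p, hp, hd⟩ := Nat.exists_prime_and_dvd h
  exact h2 p hp hd (h1 p hp hd)

/-- `σ` is `π` or its complement. -/
def Side (π σ : Set ℕ) : Prop := σ = π ∨ σ = πᶜ

lemma piSep_iff {π : Set ℕ} {G : Type*} [Group G] : PiSeparable π G ↔
    ∃ (n : ℕ) (c : Fin (n + 1) → Subgroup G),
    c 0 = ⊥ ∧ c (Fin.last n) = ⊤ ∧ Monotone c ∧ (∀ k, (c k).Normal) ∧
    ∀ k : Fin n, ∃ σ, Side π σ ∧ SNum σ ((c k.castSucc).relIndex (c k.succ)) := by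
  constructor
  · rintro ⟨n, c, h0, h1, hm, hn, h⟩
    refine ⟨n, c, h0, h1, hm, hn, fun k => ?_⟩
    rcases h k with h | h
    · exact ⟨π, Or.inl rfl, h⟩
    · exact ⟨πᶜ, Or.inr rfl, h⟩
  · rintro ⟨n, c, h0, h1, hm, hn, h⟩
    refine ⟨n, c, h0, h1, hm, hn, fun k => ?_⟩
    obtain ⟨σ, hs, hk⟩ := h k
    rcases hs with hs | hs
    · subst hs; exact Or.inl hk
    · subst hs; exact Or.inr hk

lemma piSep_of_injective {π : Set ℕ} {G H : Type*} [Group G] [Group H] (f : H →* G)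
    (hf : Function.Injective f) (h : PiSeparable π G) : PiSeparable π H := by
  rw [piSep_iff] at h ⊢
  obtain ⟨n, c, h0, h1, hm, hn, h⟩ := h
  refine ⟨n, fun k => (c k).comap f, ?_, ?_, ?_, ?_, ?_⟩
  · simp only [h0]; exact (MonoidHom.ker_eq_bot_iff f).2 hf
  · simp [h1]
  · intro a b hab; exact Subgroup.comap_mono (hm hab)
  · intro k; have := hn k; infer_instance
  · intro k
    obtain ⟨σ, hs, hk⟩ := h k
    refine ⟨σ, hs, hk.dvd ?_⟩
    have := hn k.castSucc
    rw [Subgroup.relIndex_comap]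
    have hle : Subgroup.map f (Subgroup.comap f (c k.succ)) ≤ c k.succ := Subgroup.map_comap_le _ _
    have hle2 : c k.castSucc ≤ c k.succ := hm (Fin.castSucc_le_succ k)
    rw [← Subgroup.relIndex_subgroupOf hle]
    exact Subgroup.relIndex_dvd_index_of_normal _ _

lemma piSep_of_surjective {π : Set ℕ} {G H : Type*} [Group G] [Group H] (f : G →* H)
    (hf : Function.Surjective f) (h : PiSeparable π G) : PiSeparable π H := by
  rw [piSep_iff] at h ⊢
  obtain ⟨n, c, h0, h1, hm, hn, h⟩ := h
  refine ⟨n, fun k => (c k).map f, ?_, ?_, ?_, ?_, ?_⟩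
  · simp [h0]
  · simp only [h1]; exact Subgroup.map_top_of_surjective f hf
  · intro a b hab; exact Subgroup.map_mono (hm hab)
  · intro k; exact (hn k).map f hf
  · intro k
    obtain ⟨σ, hs, hk⟩ := h k
    refine ⟨σ, hs, hk.dvd ?_⟩
    have := hn k.castSucc
    have hle2 : c k.castSucc ≤ c k.succ := hm (Fin.castSucc_le_succ k)
    have he : c k.succ ⊔ f.ker = c k.succ ⊔ (c k.castSucc ⊔ f.ker) := by
      rw [← sup_assoc, sup_eq_left.2 hle2]
    rw [Subgroup.relIndex_map_map, he, Subgroup.relIndex_sup_right]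
    exact Subgroup.relIndex_dvd_of_le_left _ le_sup_left

/-- prepend -/
lemma piSep_ext_base {π σ : Set ℕ} (hσ : Side π σ) {G : Type*} [Group G] (M : Subgroup G) [M.Normal]
    (hM : SNum σ (Nat.card M)) (h : PiSeparable π (G ⧸ M)) : PiSeparable π G := by
  rw [piSep_iff] at h ⊢
  obtain ⟨n, c, h0, h1, hm, hn, h⟩ := h
  refine ⟨n + 1, Fin.cons ⊥ (fun k => (c k).comap (QuotientGroup.mk' M)), ?_, ?_, ?_, ?_, ?_⟩
  · simp
  · rw [← Fin.succ_last, Fin.cons_succ, h1]; simp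
  · intro a b hab
    induction a using Fin.cases with
    | zero => simp
    | succ a =>
      induction b using Fin.cases with
      | zero => simp at hab
      | succ b =>
        simp only [Fin.cons_succ]
        exact Subgroup.comap_mono (hm (by simpa using hab))
  · intro k
    induction k using Fin.cases with
    | zero => simp only [Fin.cons_zero]; infer_instance
    | succ k => simp only [Fin.cons_succ]; have := hn k; infer_instance
  · intro k
    induction k using Fin.cases with
    | zero =>
      refine ⟨σ, hσ, ?_⟩
      simp only [Fin.cons_succ, Fin.castSucc_zero, Fin.cons_zero, h0, Subgroup.relIndex_bot_left]
      convert hM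
      exact QuotientGroup.ker_mk' M
    | succ k =>
      obtain ⟨τ, hs, hk⟩ := h k
      refine ⟨τ, hs, ?_⟩
      rw [← Fin.succ_castSucc, Fin.cons_succ, Fin.cons_succ, Subgroup.relIndex_comap,
        Subgroup.map_comap_eq_self_of_surjective (QuotientGroup.mk'_surjective M)]
      exact hk

/-- a nontrivial π-separable group has a nontrivial normal σ-subgroup. -/
lemma exists_normal {π : Set ℕ} {G : Type*} [Group G] [Nontrivial G] (h : PiSeparable π G) :
    ∃ σ, Side π σ ∧ ∃ M : Subgroup G, M.Normal ∧ M ≠ ⊥ ∧ SNum σ (Nat.card M) := by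
  rw [piSep_iff] at h
  obtain ⟨n, c, h0, h1, hm, hn, h⟩ := h
  by_contra hcon
  push Not at hcon
  have key : ∀ k : Fin (n + 1), c k = ⊥ := by
    intro k
    induction k using Fin.induction with
    | zero => exact h0
    | succ k ih =>
      by_contra hne
      obtain ⟨σ, hs, hk⟩ := h k
      rw [ih, Subgroup.relIndex_bot_left] at hk
      exact hcon σ hs _ (hn _) hne hk
  have := key (Fin.last n)
  rw [h1] at this
  exact top_ne_bot this

lemma snum_sup {σ : Set ℕ} {G : Type*} [Group G] [Finite G] (K L : Subgroup G) [L.Normal]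
    (hK : SNum σ (Nat.card K)) (hL : SNum σ (Nat.card L)) :
    SNum σ (Nat.card (K ⊔ L : Subgroup G)) := by
  have h1 : L.relIndex (K ⊔ L) = L.relIndex K := Subgroup.relIndex_sup_right _ _
  have h2 := Subgroup.relIndex_mul_relIndex (⊥ : Subgroup G) L (K ⊔ L) bot_le le_sup_right
  rw [Subgroup.relIndex_bot_left, Subgroup.relIndex_bot_left, h1] at h2
  rw [← h2]
  exact hL.mul (hK.dvd (Subgroup.relIndex_dvd_card _ _))

/-- characteristic σ-radical containing a given one. -/
lemma exists_char {σ : Set ℕ} {G : Type*} [Group G] [Finite G] (M : Subgroup G) (hM : M.Normal)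
    (hs : SNum σ (Nat.card M)) :
    ∃ K : Subgroup G, M ≤ K ∧ K.Characteristic ∧ SNum σ (Nat.card K) := by
  obtain ⟨K, hMK, hK⟩ := (Set.toFinite {K : Subgroup G | K.Normal ∧ SNum σ (Nat.card K)}).exists_le_maximal
    (show M ∈ _ from ⟨hM, hs⟩)
  refine ⟨K, hMK, ?_, hK.prop.2⟩
  rw [Subgroup.characteristic_iff_map_le]
  intro φ
  have hKn := hK.prop.1
  have hn : (K.map φ.toMonoidHom).Normal := hKn.map _ φ.surjective
  have hc : SNum σ (Nat.card (K.map φ.toMonoidHom)) := by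
    rw [Subgroup.card_map_of_injective φ.injective]; exact hK.prop.2
  have : K ⊔ K.map φ.toMonoidHom ≤ K :=
    hK.le_of_ge ⟨inferInstance, snum_sup _ _ hK.prop.2 hc⟩ le_sup_left
  exact le_sup_right.trans this

lemma piSep_ext {π : Set ℕ} : ∀ (n : ℕ) {G : Type*} [Group G] [Finite G] (N : Subgroup G) [N.Normal],
    Nat.card N = n → PiSeparable π N → PiSeparable π (G ⧸ N) → PiSeparable π G := by
  intro n
  induction n using Nat.strong_induction_on with
  | _ n ih =>
    intro G _ _ N _ hn hN hQ
    by_cases hbot : N = ⊥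
    · subst hbot
      exact piSep_of_injective (QuotientGroup.mk' ⊥)
        ((MonoidHom.ker_eq_bot_iff _).1 (QuotientGroup.ker_mk' _)) hQ
    have : Nontrivial N := (Subgroup.nontrivial_iff_ne_bot N).2 hbot
    obtain ⟨σ, hσ, M0, hM0, hMzb, hs⟩ := exists_normal hN
    obtain ⟨K, hMK, hKc, hKs⟩ := exists_char M0 hM0 hs
    let M : Subgroup G := K.map N.subtype
    have hMn : M.Normal := inferInstance
    have hMs : SNum σ (Nat.card M) := by
      rw [Subgroup.card_map_of_injective N.subtype_injective]; exact hKs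
    have hMN : M ≤ N := Subgroup.map_subtype_le _
    refine piSep_ext_base hσ M hMs ?_
    have hNn : (N.map (QuotientGroup.mk' M)).Normal :=
      Subgroup.Normal.map ‹_› _ (QuotientGroup.mk'_surjective M)
    refine ih _ ?_ (N.map (QuotientGroup.mk' M)) rfl ?_ ?_
    · rw [← hn]
      have h1 := Subgroup.relIndex_ker (K := N) (QuotientGroup.mk' M)
      rw [QuotientGroup.ker_mk'] at h1
      rw [← h1]
      have h2 := Subgroup.relIndex_mul_relIndex (⊥ : Subgroup G) M N bot_le hMN
      rw [Subgroup.relIndex_bot_left, Subgroup.relIndex_bot_left] at h2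
      have hMb : M ≠ ⊥ := by
        intro h
        rw [Subgroup.map_eq_bot_iff_of_injective _ N.subtype_injective] at h
        exact hMzb (le_bot_iff.1 (h ▸ hMK))
      have h3 : 1 < Nat.card M := (Subgroup.one_lt_card_iff_ne_bot M).2 hMb
      have h4 : 0 < Nat.card N := Nat.card_pos
      rw [← h2] at h4 ⊢
      have h5 : 0 < M.relIndex N := Nat.pos_of_mul_pos_left h4
      nlinarith
    · exact piSep_of_surjective ((QuotientGroup.mk' M).subgroupMap N)
        (MonoidHom.subgroupMap_surjective _ _) hN
    · exact piSep_of_surjective (QuotientGroup.quotientQuotientEquivQuotient M N hMN).symm.toMonoidHom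
        (QuotientGroup.quotientQuotientEquivQuotient M N hMN).symm.surjective hQ


/-- If an average of roots of unity is an algebraic integer then it is zero or all are equal. -/
lemma avg_roots {d n : ℕ} (hd : 0 < d) (hn : 0 < n) (z : Fin d → ℂ) (hz : ∀ i, z i ^ n = 1)
    (hint : IsIntegral ℤ ((∑ i, z i) / (d : ℂ))) : (∑ i, z i) = 0 ∨ ∃ u, ∀ i, z i = u := by
  have hnorm : ∀ w : ℂ, w ^ n = 1 → ‖w‖ = 1 := fun w hw => Complex.norm_eq_one_of_pow_eq_one hw hn.ne'
  have hdC : (d : ℂ) ≠ 0 := by exact_mod_cast hd.ne'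
  have hdR : (0 : ℝ) < d := by exact_mod_cast hd
  by_cases h0 : (∑ i, z i) = 0
  · exact Or.inl h0
  right
  let K : IntermediateField ℚ ℂ := IntermediateField.adjoin ℚ (Set.range z)
  have hfd : FiniteDimensional ℚ K := by
    have : Finite (Set.range z) := Set.finite_range z
    refine IntermediateField.finiteDimensional_adjoin ?_
    rintro x ⟨i, rfl⟩
    exact IsIntegral.of_pow hn (by rw [hz i]; exact isIntegral_one)
  have hnf : NumberField K := { }
  let y : Fin d → K := fun i => ⟨z i, IntermediateField.subset_adjoin ℚ _ ⟨i, rfl⟩⟩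
  let x : K := (∑ i, y i) / (d : K)
  have hx : ((x : K) : ℂ) = (∑ i, z i) / (d : ℂ) := by simp [x, y]
  have hx0 : x ≠ 0 := by
    intro h
    rw [h] at hx
    exact div_ne_zero h0 hdC hx.symm
  have hxi : IsIntegral ℤ x := by
    rw [← hx] at hint
    exact (isIntegral_algHom_iff (K.val.restrictScalars ℤ) K.val.injective).1 hint
  obtain ⟨m, hm, hxm⟩ := NumberField.Embeddings.pow_eq_one_of_norm_le_one K ℂ hx0 hxi (by
    intro φ
    have h1 : φ x = (∑ i, φ (y i)) / (d : ℂ) := by simp [x]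
    have h2 : ‖∑ i, φ (y i)‖ ≤ d := by
      refine (norm_sum_le _ _).trans ?_
      have : ∀ i, ‖φ (y i)‖ = 1 := fun i => hnorm _ (by
        rw [← map_pow]
        have : y i ^ n = 1 := Subtype.ext (by simpa [y] using hz i)
        rw [this, map_one])
      simp [this]
    rw [h1, norm_div, Complex.norm_natCast, div_le_one hdR]
    exact h2)
  have hu : ‖(∑ i, z i) / (d : ℂ)‖ = 1 := by
    refine Complex.norm_eq_one_of_pow_eq_one (n := m) ?_ hm.ne'
    rw [← hx]
    exact_mod_cast congrArg (Subtype.val) hxm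
  set u := (∑ i, z i) / (d : ℂ) with hudef
  refine ⟨u, ?_⟩
  -- distances
  have hdist : ∀ w : ℂ, ‖w‖ = 1 → Complex.normSq (w - u) = 2 - 2 * (w * (starRingEnd ℂ) u).re := by
    intro w hw
    rw [Complex.normSq_sub, Complex.normSq_eq_norm_sq, Complex.normSq_eq_norm_sq, hw, hu]
    ring
  have hsum : ∑ i, Complex.normSq (z i - u) = 0 := by
    have h1 : ∀ i, Complex.normSq (z i - u) = 2 - 2 * (z i * (starRingEnd ℂ) u).re :=
      fun i => hdist _ (hnorm _ (hz i))
    simp_rw [h1]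
    rw [Finset.sum_sub_distrib, ← Finset.mul_sum, ← Complex.re_sum, ← Finset.sum_mul]
    have h2 : (∑ i, z i) = d * u := by rw [hudef]; field_simp
    rw [h2, mul_assoc, Complex.mul_conj, Complex.normSq_eq_norm_sq, hu]
    simp
    ring
  intro i
  have := (Finset.sum_eq_zero_iff_of_nonneg (fun i _ => Complex.normSq_nonneg _)).1 hsum i (Finset.mem_univ i)
  exact sub_eq_zero.1 (Complex.normSq_eq_zero.1 this)

open Polynomial in
lemma root_pow_one {d n : ℕ} (A : Matrix (Fin d) (Fin d) ℂ) (hA : A ^ n = 1)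
    (w : ℂ) (hw : w ∈ A.charpoly.roots) : w ^ n = 1 := by
  have hev : Module.End.HasEigenvalue (Matrix.toLin' A) w := by
    rw [Module.End.hasEigenvalue_iff_isRoot_charpoly, Matrix.charpoly_toLin']
    exact (Polynomial.mem_roots'.1 hw).2
  obtain ⟨v, hv⟩ := hev.exists_hasEigenvector
  have h1 := hv.pow_apply n
  rw [← Matrix.toLin'_pow, hA, Matrix.toLin'_one, LinearMap.id_apply] at h1
  have h2 : (w ^ n - 1) • v = 0 := by rw [sub_smul, one_smul, ← h1, sub_self]
  exact sub_eq_zero.1 ((smul_eq_zero.1 h2).resolve_right hv.2)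

lemma isIntegral_trace {d n : ℕ} (hn : 0 < n) (A : Matrix (Fin d) (Fin d) ℂ) (hA : A ^ n = 1) :
    IsIntegral ℤ A.trace := by
  rw [Matrix.trace_eq_sum_roots_charpoly]
  refine IsIntegral.multiset_sum ?_
  intro w hw
  exact IsIntegral.of_pow hn (by rw [root_pow_one A hA w hw]; exact isIntegral_one)

open Polynomial in
lemma trace_zero_or_scalar {d n : ℕ} (hd : 0 < d) (hn : 0 < n) (A : Matrix (Fin d) (Fin d) ℂ)
    (hA : A ^ n = 1) (hint : IsIntegral ℤ (A.trace / (d : ℂ))) :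
    A.trace = 0 ∨ ∃ u : ℂ, A = Matrix.scalar (Fin d) u := by
  have hsp : A.charpoly.Splits := IsAlgClosed.splits _
  have hcard : A.charpoly.roots.card = d := by
    rw [← hsp.natDegree_eq_card_roots, Matrix.charpoly_natDegree_eq_dim, Fintype.card_fin]
  obtain ⟨z, hz⟩ : ∃ z : Fin d → ℂ, A.charpoly.roots = Multiset.map z Finset.univ.val := by
    have hl : A.charpoly.roots.toList.length = d := by simpa using hcard
    refine ⟨fun i => A.charpoly.roots.toList.get (i.cast hl.symm), ?_⟩
    conv_lhs => rw [← Multiset.coe_toList A.charpoly.roots]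
    generalize A.charpoly.roots.toList = l at hl
    subst hl
    simp [Fin.univ_val_map]
  have htr : A.trace = ∑ i, z i := by
    rw [Matrix.trace_eq_sum_roots_charpoly, hz]; rfl
  have hzn : ∀ i, z i ^ n = 1 := fun i => root_pow_one A hA _ (by rw [hz]; simp)
  rw [htr] at hint ⊢
  rcases avg_roots hd hn z hzn hint with h | ⟨u, hu⟩
  · exact Or.inl h
  right
  refine ⟨u, ?_⟩
  have hch : A.charpoly = (X - C u) ^ d := by
    rw [hsp.eq_prod_roots_of_monic (Matrix.charpoly_monic A), hz]
    simp [hu]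
  have hmd : minpoly ℂ A ∣ (X - C u) ^ d := by
    rw [← hch]; exact Matrix.minpoly_dvd_charpoly A
  have hmd2 : minpoly ℂ A ∣ X ^ n - C 1 := by
    refine minpoly.dvd _ _ ?_
    simp [hA]
  have hsq : Squarefree (X ^ n - C (1 : ℂ)) :=
    (separable_X_pow_sub_C 1 (by exact_mod_cast hn.ne') one_ne_zero).squarefree
  have hsq2 := hsq.squarefree_of_dvd hmd2
  obtain ⟨i, -, hi⟩ := (dvd_prime_pow (prime_X_sub_C u) d).1 hmd
  have hi1 : i ≤ 1 := by
    by_contra hcon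
    have : (X - C u) * (X - C u) ∣ minpoly ℂ A := by
      refine dvd_trans ?_ hi.symm.dvd
      rw [← sq]
      exact pow_dvd_pow _ (by omega)
    exact (prime_X_sub_C u).not_isUnit (hsq2 _ this)
  have hdv : minpoly ℂ A ∣ X - C u := by
    refine hi.dvd.trans ?_
    calc (X - C u) ^ i ∣ (X - C u) ^ 1 := pow_dvd_pow _ hi1
      _ = _ := pow_one _
  obtain ⟨r, hr⟩ := hdv
  have h0 : aeval A (X - C u) = 0 := by rw [hr, map_mul, minpoly.aeval, zero_mul]
  simp only [map_sub, aeval_X, aeval_C] at h0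
  rw [sub_eq_zero.1 h0]
  rfl

lemma trace_mulLeft_matrix_pi {m : ℕ} (d : Fin m → ℕ)
    (a : Π i, Matrix (Fin (d i)) (Fin (d i)) ℂ) :
    LinearMap.trace ℂ _ (LinearMap.mulLeft ℂ a) = ∑ i, (d i : ℂ) * (a i).trace := by
  let b : Module.Basis (Σ i : Fin m, Fin (d i) × Fin (d i)) ℂ (Π i, Matrix (Fin (d i)) (Fin (d i)) ℂ) :=
    Pi.basis fun i => Matrix.stdBasis ℂ (Fin (d i)) (Fin (d i))
  rw [LinearMap.trace_eq_matrix_trace ℂ b, Matrix.trace, Fintype.sum_sigma]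
  refine Finset.sum_congr rfl fun i _ => ?_
  have h : ∀ x : Fin (d i) × Fin (d i),
      (LinearMap.toMatrix b b (LinearMap.mulLeft ℂ a)).diag ⟨i, x⟩ = a i x.1 x.1 := by
    rintro ⟨j, k⟩
    rw [Matrix.diag_apply, LinearMap.toMatrix_apply]
    simp [b, Pi.basis_repr, Pi.basis_apply, Matrix.stdBasis_eq_single]
    have hr : ∀ M : Matrix (Fin (d i)) (Fin (d i)) ℂ,
        (Matrix.stdBasis ℂ (Fin (d i)) (Fin (d i))).repr M (j, k) = M j k := by
      intro M
      simp [Matrix.stdBasis, Pi.basis_repr]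
    rw [hr]
    simp
  simp_rw [h]
  rw [Fintype.sum_prod_type]
  simp [Matrix.trace, Finset.mul_sum]

lemma trace_mulLeft_of {G : Type*} [Group G] [Finite G] (g : G) (hg : g ≠ 1) :
    LinearMap.trace ℂ _ (LinearMap.mulLeft ℂ (MonoidAlgebra.of ℂ G g)) = 0 := by
  classical
  have := Fintype.ofFinite G
  let b : Module.Basis G ℂ (MonoidAlgebra ℂ G) := Module.Basis.ofRepr (MonoidAlgebra.coeffLinearEquiv ℂ)
  rw [LinearMap.trace_eq_matrix_trace ℂ b, Matrix.trace]
  refine Finset.sum_eq_zero fun x _ => ?_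
  rw [Matrix.diag_apply, LinearMap.toMatrix_apply]
  simp [b]
  exact Finsupp.single_eq_of_ne (by simpa using hg)

/-- The data: a Wedderburn decomposition. Per component statement. -/
lemma component {G : Type*} [Group G] [Finite G] {d : ℕ} (hd : 0 < d)
    (f : MonoidAlgebra ℂ G →ₐ[ℂ] Matrix (Fin d) (Fin d) ℂ) (hf : Function.Surjective f)
    (g : G) (S : Finset G) (hS : ∀ x, x ∈ S ↔ IsConj g x) {p k : ℕ} (hp : p.Prime)
    (hSc : S.card = p ^ k) :
    p ∣ d ∨ (f (MonoidAlgebra.of ℂ G g)).trace = 0 ∨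
      ∃ u : ℂ, f (MonoidAlgebra.of ℂ G g) = Matrix.scalar (Fin d) u := by
  by_cases hpd : p ∣ d
  · exact Or.inl hpd
  right
  have hdC : (d : ℂ) ≠ 0 := by exact_mod_cast hd.ne'
  let n := Nat.card G
  have hn : 0 < n := Nat.card_pos
  have hpow : f (MonoidAlgebra.of ℂ G g) ^ n = 1 := by
    rw [← map_pow, ← map_pow, pow_card_eq_one', map_one, map_one]
  refine trace_zero_or_scalar hd hn _ hpow ?_
  -- class sum
  let z0 : MonoidAlgebra ℤ G := ∑ x ∈ S, MonoidAlgebra.of ℤ G x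
  let z : MonoidAlgebra ℂ G := ∑ x ∈ S, MonoidAlgebra.of ℂ G x
  have hz0 : IsIntegral ℤ z0 := by
    have : Module.Finite ℤ (MonoidAlgebra ℤ G) := inferInstance
    exact IsIntegral.of_finite ℤ z0
  have hz : IsIntegral ℤ z := by
    have h := map_isIntegral_int (MonoidAlgebra.mapRingHom G (Int.castRingHom ℂ)) hz0
    have : MonoidAlgebra.mapRingHom G (Int.castRingHom ℂ) z0 = z := by
      simp [z0, z]
    rwa [this] at h
  have hcomm1 : ∀ y : G, MonoidAlgebra.of ℂ G y * z = z * MonoidAlgebra.of ℂ G y := by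
    intro y
    simp only [z, Finset.mul_sum, Finset.sum_mul]
    refine Finset.sum_bij (fun x _ => y * x * y⁻¹) ?_ ?_ ?_ ?_
    · intro x hx
      rw [hS] at hx ⊢
      exact hx.trans (isConj_iff.2 ⟨y, rfl⟩)
    · intro a _ b _ h
      simpa using h
    · intro x hx
      refine ⟨y⁻¹ * x * y, ?_, by group⟩
      rw [hS] at hx ⊢
      exact hx.trans (isConj_iff.2 ⟨y⁻¹, by simp⟩)
    · intro x _
      rw [← map_mul, ← map_mul]
      congr 1
      group
  have hcomm : ∀ a : MonoidAlgebra ℂ G, a * z = z * a := by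
    intro a
    induction a using MonoidAlgebra.induction_on with
    | of y => exact hcomm1 y
    | add a b ha hb => rw [add_mul, mul_add, ha, hb]
    | smul r a ha => rw [smul_mul_assoc, mul_smul_comm, ha]
  have hcen : f z ∈ Set.center (Matrix (Fin d) (Fin d) ℂ) := by
    rw [Semigroup.mem_center_iff]
    intro M
    obtain ⟨a, rfl⟩ := hf M
    rw [← map_mul, ← map_mul, hcomm]
  rw [Matrix.center_eq_scalar_image] at hcen
  obtain ⟨l, -, hl⟩ := hcen
  have hlint : IsIntegral ℤ l := by
    have h1 : IsIntegral ℤ (f z) := map_isIntegral_int f hz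
    rw [← hl] at h1
    have : Nonempty (Fin d) := ⟨⟨0, hd⟩⟩
    exact (isIntegral_algHom_iff ((Matrix.scalar (Fin d) : ℂ →+* _).toIntAlgHom)
      (fun a b hab => Matrix.scalar_inj.1 hab)).1 h1
  have htr : (d : ℂ) * l = (p : ℂ) ^ k * (f (MonoidAlgebra.of ℂ G g)).trace := by
    have h1 : (f z).trace = d * l := by
      rw [← hl]; simp [Matrix.scalar_apply, Matrix.trace_diagonal]
    rw [← h1]
    have h2 : ∀ x ∈ S, (f (MonoidAlgebra.of ℂ G x)).trace = (f (MonoidAlgebra.of ℂ G g)).trace := by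
      intro x hx
      obtain ⟨y, rfl⟩ := isConj_iff.1 ((hS x).1 hx)
      rw [map_mul, map_mul, Matrix.trace_mul_comm, ← map_mul, ← map_mul]
      congr 3
      group
    simp only [z, map_sum, Matrix.trace_sum]
    rw [Finset.sum_congr rfl h2, Finset.sum_const, hSc]
    simp
  have hco : IsCoprime ((p : ℤ) ^ k) (d : ℤ) := by
    have : Nat.Coprime (p ^ k) d := Nat.Coprime.pow_left _ ((Nat.Prime.coprime_iff_not_dvd hp).2 hpd)
    exact_mod_cast Nat.isCoprime_iff_coprime.2 this
  obtain ⟨u, v, huv⟩ := hco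
  have huvC : (u : ℂ) * (p : ℂ) ^ k + v * d = 1 := by exact_mod_cast congrArg (Int.cast (R := ℂ)) huv
  have : (f (MonoidAlgebra.of ℂ G g)).trace / (d : ℂ)
      = (u : ℂ) * l + (v : ℂ) * (f (MonoidAlgebra.of ℂ G g)).trace := by
    field_simp
    linear_combination (u : ℂ) * (- htr) + (-(f (MonoidAlgebra.of ℂ G g)).trace) * huvC
  rw [this]
  exact ((isIntegral_algebraMap (R := ℤ) (A := ℂ) (x := u)).mul hlint).add
    ((isIntegral_algebraMap (R := ℤ) (A := ℂ) (x := v)).mul (isIntegral_trace hn _ hpow))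

lemma trivial_of_scalar {G : Type*} [Group G] [IsSimpleGroup G]
    (hnc : ¬ ∀ a b : G, a * b = b * a) {d : ℕ}
    (f : MonoidAlgebra ℂ G →ₐ[ℂ] Matrix (Fin d) (Fin d) ℂ) (g : G) (hg : g ≠ 1)
    (hu : ∃ u : ℂ, f (MonoidAlgebra.of ℂ G g) = Matrix.scalar (Fin d) u) :
    ∀ x, f (MonoidAlgebra.of ℂ G x) = 1 := by
  let ρ : G →* Matrix (Fin d) (Fin d) ℂ := (f : MonoidAlgebra ℂ G →* _).comp (MonoidAlgebra.of ℂ G)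
  have hρ : ∀ x, ρ x = f (MonoidAlgebra.of ℂ G x) := fun x => rfl
  have hinv : ∀ x, ρ x * ρ x⁻¹ = 1 := fun x => by rw [← map_mul, mul_inv_cancel, map_one]
  have hinv' : ∀ x, ρ x⁻¹ * ρ x = 1 := fun x => by rw [← map_mul, inv_mul_cancel, map_one]
  let Z : Subgroup G :=
    { carrier := {x | ∀ y, ρ x * ρ y = ρ y * ρ x}
      mul_mem' := by
        intro a b ha hb y
        rw [map_mul, mul_assoc, hb y, ← mul_assoc, ha y, mul_assoc]
      one_mem' := by intro y; simp
      inv_mem' := by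
        intro a ha y
        calc ρ a⁻¹ * ρ y = ρ a⁻¹ * (ρ y * ρ a) * ρ a⁻¹ := by
              rw [mul_assoc, mul_assoc, hinv, mul_one]
          _ = ρ y * ρ a⁻¹ := by rw [← ha y, ← mul_assoc, hinv', one_mul] }
  have hZn : Z.Normal := ⟨by
    intro a ha y
    have : ρ (y * a * y⁻¹) = ρ a := by
      rw [map_mul, map_mul, ← ha y, mul_assoc, hinv, mul_one]
    intro w
    rw [this]; exact ha w⟩
  have hgZ : g ∈ Z := by
    intro y
    obtain ⟨u, hu⟩ := hu
    rw [hρ g, hu]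
    exact (Matrix.scalar_commute u (fun _ => mul_comm _ _) _).eq
  have hZt : Z = ⊤ := by
    refine (hZn.eq_bot_or_eq_top).resolve_left ?_
    intro h
    rw [h] at hgZ
    exact hg (Subgroup.mem_bot.1 hgZ)
  let N : Subgroup G := ρ.ker
  have hNt : N = ⊤ := by
    refine ((inferInstance : N.Normal).eq_bot_or_eq_top).resolve_left ?_
    intro h
    apply hnc
    intro a b
    have h1 : a * b * (b * a)⁻¹ ∈ N := by
      rw [MonoidHom.mem_ker]
      have hab : ρ (a * b) = ρ (b * a) := by
        have : a ∈ Z := hZt ▸ Subgroup.mem_top a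
        rw [map_mul, map_mul, this b]
      rw [map_mul, hab, hinv]
    rw [h, Subgroup.mem_bot] at h1
    exact mul_inv_eq_one.1 h1
  intro x
  have : x ∈ N := hNt ▸ Subgroup.mem_top x
  exact this

lemma burnside_core {G : Type*} [Group G] [Finite G] [IsSimpleGroup G]
    (hnc : ¬ ∀ a b : G, a * b = b * a) (g : G) (hg : g ≠ 1) (S : Finset G)
    (hS : ∀ x, x ∈ S ↔ IsConj g x) {p k : ℕ} (hp : p.Prime) (hSc : S.card = p ^ k) : False := by
  classical
  have := Fintype.ofFinite G
  have hss : IsSemisimpleRing (MonoidAlgebra ℂ G) := by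
    have : NeZero (Nat.card G : ℂ) := ⟨by exact_mod_cast Nat.card_pos.ne'⟩
    infer_instance
  obtain ⟨m, d, hd, ⟨e⟩⟩ := IsSemisimpleRing.exists_algEquiv_pi_matrix_of_isAlgClosed ℂ (MonoidAlgebra ℂ G)
  let f : ∀ i, MonoidAlgebra ℂ G →ₐ[ℂ] Matrix (Fin (d i)) (Fin (d i)) ℂ := fun i =>
    (Pi.evalAlgHom ℂ (fun i => Matrix (Fin (d i)) (Fin (d i)) ℂ) i).comp e.toAlgHom
  have hfe : ∀ i a, f i a = e a i := fun i a => rfl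
  have hf : ∀ i, Function.Surjective (f i) := by
    intro i M
    refine ⟨e.symm (Pi.single i M), ?_⟩
    rw [hfe]; simp
  have hdpos : ∀ i, 0 < d i := fun i => Nat.pos_of_ne_zero (hd i).out
  let ε : MonoidAlgebra ℂ G →ₐ[ℂ] ℂ := MonoidAlgebra.lift ℂ ℂ G 1
  have hε : ∀ x, ε (MonoidAlgebra.of ℂ G x) = 1 := by intro x; simp [ε]
  -- trivial components
  have htriv : ∀ i, (∀ x, f i (MonoidAlgebra.of ℂ G x) = 1) → ∀ a, f i a = ε a • 1 := by
    intro i hi a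
    induction a using MonoidAlgebra.induction_on with
    | of y => rw [hi, hε, one_smul]
    | add a b ha hb => rw [map_add, map_add, add_smul, ha, hb]
    | smul r a ha => rw [map_smul, map_smul, ha, smul_assoc]
  have hdim : ∀ i, (∀ x, f i (MonoidAlgebra.of ℂ G x) = 1) → d i = 1 := by
    intro i hi
    by_contra hne
    have h2 : 1 < d i := by have := hdpos i; omega
    obtain ⟨a, ha⟩ := hf i (Matrix.single ⟨0, hdpos i⟩ ⟨1, h2⟩ 1)
    rw [htriv i hi] at ha
    have := congrFun (congrFun ha ⟨0, hdpos i⟩) ⟨1, h2⟩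
    simp at this
  have hone : ∀ i, (1 : Matrix (Fin (d i)) (Fin (d i)) ℂ) ≠ 0 := by
    intro i
    have : Nonempty (Fin (d i)) := ⟨⟨0, hdpos i⟩⟩
    exact one_ne_zero
  have huniq : ∀ i j, (∀ x, f i (MonoidAlgebra.of ℂ G x) = 1) →
      (∀ x, f j (MonoidAlgebra.of ℂ G x) = 1) → i = j := by
    intro i j hi hj
    by_contra hij
    let a := e.symm (Pi.single i 1)
    have h1 : f i a = 1 := by rw [hfe]; simp [a]
    have h2 : f j a = 0 := by
      rw [hfe]; simp only [a, AlgEquiv.apply_symm_apply]; exact Pi.single_eq_of_ne (Ne.symm hij) _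
    rw [htriv i hi] at h1
    rw [htriv j hj] at h2
    have h3 : ε a = 0 := (smul_eq_zero.1 h2).resolve_right (hone j)
    rw [h3, zero_smul] at h1
    exact hone i h1.symm
  have hex : ∃ i, ∀ x, f i (MonoidAlgebra.of ℂ G x) = 1 := by
    let s : MonoidAlgebra ℂ G := ∑ x : G, MonoidAlgebra.of ℂ G x
    have hl : ∀ y, MonoidAlgebra.of ℂ G y * s = s := by
      intro y
      simp only [s, Finset.mul_sum, ← map_mul]
      exact Fintype.sum_equiv (Equiv.mulLeft y) _ _ (fun x => rfl)
    have hr : ∀ y, s * MonoidAlgebra.of ℂ G y = s := by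
      intro y
      simp only [s, Finset.sum_mul, ← map_mul]
      exact Fintype.sum_equiv (Equiv.mulRight y) _ _ (fun x => rfl)
    have hs0 : s ≠ 0 := by
      intro h
      have h1 : ε s = Nat.card G := by simp only [s, map_sum, hε]; simp
      rw [h, map_zero] at h1
      exact Nat.card_pos.ne' (by exact_mod_cast h1.symm : Nat.card G = 0)
    have hcomm : ∀ a, a * s = s * a := by
      intro a
      induction a using MonoidAlgebra.induction_on with
      | of y => rw [hl, hr]
      | add a b ha hb => rw [add_mul, mul_add, ha, hb]
      | smul r a ha => rw [smul_mul_assoc, mul_smul_comm, ha]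
    have : ∃ i, f i s ≠ 0 := by
      by_contra hcon
      push Not at hcon
      apply hs0
      apply e.injective
      rw [map_zero]
      funext i
      exact hcon i
    obtain ⟨i, hi⟩ := this
    refine ⟨i, fun x => ?_⟩
    have hcen : f i s ∈ Set.center (Matrix (Fin (d i)) (Fin (d i)) ℂ) := by
      rw [Semigroup.mem_center_iff]
      intro M
      obtain ⟨a, rfl⟩ := hf i M
      rw [← map_mul, ← map_mul, hcomm]
    rw [Matrix.center_eq_scalar_image] at hcen
    obtain ⟨l, -, hls⟩ := hcen
    have hl0 : l ≠ 0 := by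
      rintro rfl
      rw [map_zero] at hls
      exact hi hls.symm
    have hls' : f i s = l • 1 := by rw [← hls, Matrix.smul_one_eq_diagonal]; rfl
    have h1 : f i (MonoidAlgebra.of ℂ G x) * f i s = f i s := by rw [← map_mul, hl]
    rw [hls', mul_smul_comm, mul_one] at h1
    exact smul_right_injective _ hl0 h1
  obtain ⟨i0, hi0⟩ := hex
  -- trace identity
  have htrace : ∑ i, (d i : ℂ) * (f i (MonoidAlgebra.of ℂ G g)).trace = 0 := by
    have h1 := trace_mulLeft_matrix_pi d (e (MonoidAlgebra.of ℂ G g))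
    have h2 : LinearMap.mulLeft ℂ (e (MonoidAlgebra.of ℂ G g))
        = e.toLinearEquiv.conj (LinearMap.mulLeft ℂ (MonoidAlgebra.of ℂ G g)) := by
      refine LinearMap.ext fun a => ?_
      simp [LinearEquiv.conj_apply]
    rw [h2, LinearMap.trace_conj', trace_mulLeft_of g hg] at h1
    exact h1.symm
  have hbeta : ∀ i, i ≠ i0 → ∃ β : ℂ, IsIntegral ℤ β ∧
      (d i : ℂ) * (f i (MonoidAlgebra.of ℂ G g)).trace = p * β := by
    intro i hi
    rcases component (hdpos i) (f i) (hf i) g S hS hp hSc with h | h | h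
    · obtain ⟨c, hc⟩ := h
      refine ⟨c * (f i (MonoidAlgebra.of ℂ G g)).trace, ?_, ?_⟩
      · have hpow : f i (MonoidAlgebra.of ℂ G g) ^ (Nat.card G) = 1 := by
          rw [← map_pow, ← map_pow, pow_card_eq_one', map_one, map_one]
        have hh := (isIntegral_algebraMap (R := ℤ) (A := ℂ) (x := (c : ℤ))).mul
          (isIntegral_trace Nat.card_pos _ hpow)
        simpa using hh
      · have hcC : (d i : ℂ) = p * c := by exact_mod_cast hc
        linear_combination (f i (MonoidAlgebra.of ℂ G g)).trace * hcC
    · exact ⟨0, isIntegral_zero, by rw [h]; simp⟩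
    · exact absurd (huniq i i0 (trivial_of_scalar hnc (f i) g hg h) hi0) hi
  choose! β hβ1 hβ2 using hbeta
  rw [← Finset.add_sum_erase _ _ (Finset.mem_univ i0), hi0 g, Matrix.trace_one, Fintype.card_fin,
    hdim i0 hi0, Finset.sum_congr rfl (fun i hi => hβ2 i (Finset.ne_of_mem_erase hi)),
    ← Finset.mul_sum] at htrace
  have hint : IsIntegral ℤ (∑ i ∈ Finset.univ.erase i0, β i) :=
    IsIntegral.sum _ fun i hi => hβ1 i (Finset.ne_of_mem_erase hi)
  set B := ∑ i ∈ Finset.univ.erase i0, β i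
  have hpC : (p : ℂ) ≠ 0 := by exact_mod_cast hp.ne_zero
  have hB : B = algebraMap ℚ ℂ (-(1 / (p : ℚ))) := by
    have h1 : (1 : ℂ) + p * B = 0 := by simpa using htrace
    have : B = -(1 / (p : ℂ)) := by
      field_simp
      linear_combination h1
    rw [this]; simp
  rw [hB] at hint
  have hint2 : IsIntegral ℤ (-(1 / (p : ℚ))) :=
    (isIntegral_algebraMap_iff (algebraMap ℚ ℂ).injective).1 hint
  obtain ⟨y, hy⟩ := IsIntegrallyClosed.isIntegral_iff.1 hint2
  have hpQ : (p : ℚ) ≠ 0 := by exact_mod_cast hp.ne_zero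
  have h1 : (y : ℚ) * p = -1 := by
    have : (y : ℚ) = -(1 / (p : ℚ)) := by simpa using hy
    rw [this]; field_simp
  have h2 : y * (p : ℤ) = -1 := by exact_mod_cast h1
  have h3 : (p : ℤ) ∣ 1 := ⟨-y, by linarith⟩
  exact hp.one_lt.ne' (by exact_mod_cast Int.natCast_dvd_natCast.1 (by exact_mod_cast h3) |> Nat.dvd_one.1)

lemma burnside {G : Type*} [Group G] [Finite G] [IsSimpleGroup G] {p q : ℕ} (hp : p.Prime)
    (hq : q.Prime) (h : ∀ r : ℕ, r.Prime → r ∣ Nat.card G → r = p ∨ r = q) :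
    ∀ a b : G, a * b = b * a := by
  classical
  by_contra hnc
  have := Fintype.ofFinite G
  have key : ∀ p q : ℕ, p.Prime → q.Prime →
      (∀ r : ℕ, r.Prime → r ∣ Nat.card G → r = p ∨ r = q) → ¬ p ∣ Nat.card G := by
    intro p q hp hq h hpd
    have : Fact p.Prime := ⟨hp⟩
    obtain ⟨P⟩ : Nonempty (Sylow p G) := inferInstance
    have hPb : (P : Subgroup G) ≠ ⊥ := P.ne_bot_of_dvd_card hpd
    have : Nontrivial P := (Subgroup.nontrivial_iff_ne_bot _).2 hPb
    have hc : Nontrivial (Subgroup.center P) := P.2.center_nontrivial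
    obtain ⟨⟨⟨g, hgP⟩, hgc⟩, hg1⟩ := exists_ne (1 : Subgroup.center P)
    have hg : g ≠ 1 := by
      rintro rfl
      exact hg1 rfl
    have hle : (P : Subgroup G) ≤ Subgroup.centralizer {g} := by
      intro x hx
      rw [Subgroup.mem_centralizer_singleton_iff]
      have := Subgroup.mem_center_iff.1 hgc ⟨x, hx⟩
      simpa using congrArg Subtype.val this
    have hidx : (Subgroup.centralizer {g}).index ∣ (P : Subgroup G).index :=
      Subgroup.index_dvd_of_le hle
    let S : Finset G := Finset.univ.filter (fun x => IsConj g x)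
    have hS : ∀ x, x ∈ S ↔ IsConj g x := by intro x; simp [S]
    have hcard : S.card = (Subgroup.centralizer {g}).index := by
      let φ : G →* ConjAct G := (ConjAct.toConjAct : G ≃* ConjAct G).toMonoidHom
      have hφ : Function.Surjective φ := (ConjAct.toConjAct : G ≃* ConjAct G).surjective
      have hcs : Subgroup.centralizer {g} = (MulAction.stabilizer (ConjAct G) g).comap φ := by
        ext x
        rw [Subgroup.mem_centralizer_singleton_iff, Subgroup.mem_comap, MulAction.mem_stabilizer_iff,
          ConjAct.smul_def]
        change _ ↔ x * g * x⁻¹ = g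
        rw [mul_inv_eq_iff_eq_mul]
      rw [hcs, Subgroup.index_comap_of_surjective _ hφ,
        MulAction.index_stabilizer, ← Set.ncard_coe_finset]
      congr 1
      ext x
      rw [Finset.mem_coe, hS, ConjAct.mem_orbit_conjAct]
      exact isConj_comm
    have hpow : S.card = q ^ (S.card.primeFactorsList.length) := by
      refine Nat.eq_prime_pow_of_unique_prime_dvd ?_ ?_
      · rw [hcard]; exact Subgroup.index_ne_zero_of_finite
      · intro r hr hrd
        rw [hcard] at hrd
        have h1 : r ∣ (P : Subgroup G).index := hrd.trans hidx
        rcases h r hr (h1.trans (Subgroup.index_dvd_card _)) with rfl | rfl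
        · exact absurd h1 P.not_dvd_index
        · rfl
    exact burnside_core hnc g hg S hS hq hpow
  have h1 : Nat.card G ≠ 1 := Finite.one_lt_card.ne'
  obtain ⟨r, hr, hrd⟩ := Nat.exists_prime_and_dvd h1
  rcases h r hr hrd with rfl | rfl
  · exact key _ _ hp hq h hrd
  · exact key _ _ hq hp (fun s hs hsd => (h s hs hsd).symm) hrd

lemma piSep_of_snum {π σ : Set ℕ} (hσ : Side π σ) {G : Type*} [Group G]
    (h : SNum σ (Nat.card G)) : PiSeparable π G := by
  rw [piSep_iff]
  refine ⟨1, ![⊥, ⊤], rfl, rfl, ?_, ?_, ?_⟩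
  · intro a b hab
    fin_cases a <;> fin_cases b <;> simp at hab ⊢
  · intro k
    fin_cases k
    · exact (inferInstance : (⊥ : Subgroup G).Normal)
    · exact (inferInstance : (⊤ : Subgroup G).Normal)
  · intro k
    refine ⟨σ, hσ, ?_⟩
    fin_cases k
    simpa using h

/-- Groups of order `p^a q^b` are π-separable. -/
lemma piSep_two {π : Set ℕ} {p q : ℕ} (hp : p.Prime) (hq : q.Prime) : ∀ (n : ℕ) {G : Type*} [Group G] [Finite G],
    Nat.card G = n → (∀ r : ℕ, r.Prime → r ∣ Nat.card G → r = p ∨ r = q) → PiSeparable π G := by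
  intro n
  induction n using Nat.strong_induction_on with
  | _ n ih =>
    intro G _ _ hn hr
    by_cases htriv : Subsingleton G
    · refine piSep_of_snum (σ := π) (Or.inl rfl) ?_
      intro p hp hd
      rw [Nat.card_unique] at hd
      exact absurd (Nat.dvd_one.1 hd) hp.one_lt.ne'
    have hnt : Nontrivial G := not_subsingleton_iff_nontrivial.1 htriv
    by_cases hs : IsSimpleGroup G
    · have hcomm := burnside hp hq hr
      let _ : CommGroup G := { (inferInstance : Group G) with mul_comm := hcomm }
      have hpr : (Nat.card G).Prime := IsSimpleGroup.prime_card
      by_cases hin : Nat.card G ∈ π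
      · refine piSep_of_snum (σ := π) (Or.inl rfl) ?_
        intro r hr hd
        rwa [(Nat.prime_dvd_prime_iff_eq hr hpr).1 hd]
      · refine piSep_of_snum (σ := πᶜ) (Or.inr rfl) ?_
        intro r hr hd
        rwa [(Nat.prime_dvd_prime_iff_eq hr hpr).1 hd]
    · have : ∃ N : Subgroup G, N.Normal ∧ N ≠ ⊥ ∧ N ≠ ⊤ := by
        by_contra hcon
        push Not at hcon
        exact hs ⟨fun N hN => or_iff_not_imp_left.2 (hcon N hN)⟩
      obtain ⟨N, hN, hb, ht⟩ := this
      have h1 : 1 < Nat.card N := (Subgroup.one_lt_card_iff_ne_bot N).2 hb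
      have h2 : 1 < N.index := by
        have : N.index ≠ 1 := fun h => ht (Subgroup.index_eq_one.1 h)
        have : N.index ≠ 0 := Subgroup.index_ne_zero_of_finite
        omega
      have h3 := N.index_mul_card
      have h4 : Nat.card (G ⧸ N) = N.index := rfl
      refine piSep_ext _ N rfl (ih _ ?_ rfl ?_) (ih _ ?_ rfl ?_)
      · nlinarith
      · intro r hr1 hd
        exact hr r hr1 (hd.trans (Dvd.intro_left _ h3))
      · nlinarith
      · intro r hr1 hd
        rw [h4] at hd
        exact hr r hr1 (hd.trans (Dvd.intro _ h3))

lemma relIndex_dvd_index_of_right_normal {G : Type*} [Group G] [Finite G] (B M : Subgroup G)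
    [M.Normal] : B.relIndex M ∣ B.index := by
  have e1 : Nat.card (B ⊓ M : Subgroup G) * B.relIndex M = Nat.card M := by
    have := Subgroup.relIndex_mul_relIndex (⊥ : Subgroup G) (B ⊓ M) M bot_le inf_le_right
    rwa [Subgroup.relIndex_bot_left, Subgroup.relIndex_bot_left, Subgroup.inf_relIndex_right] at this
  have e2 : Nat.card (B ⊓ M : Subgroup G) * M.relIndex B = Nat.card B := by
    have := Subgroup.relIndex_mul_relIndex (⊥ : Subgroup G) (B ⊓ M) B bot_le inf_le_left
    rwa [Subgroup.relIndex_bot_left, Subgroup.relIndex_bot_left, Subgroup.inf_relIndex_left] at this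
  have e3 : Nat.card M * M.relIndex B = Nat.card (B ⊔ M : Subgroup G) := by
    have := Subgroup.relIndex_mul_relIndex (⊥ : Subgroup G) M (B ⊔ M) bot_le le_sup_right
    rwa [Subgroup.relIndex_bot_left, Subgroup.relIndex_bot_left, Subgroup.relIndex_sup_right] at this
  have e4 : Nat.card B * B.relIndex M ∣ Nat.card B * B.index := by
    have h : Nat.card (B ⊔ M : Subgroup G) ∣ Nat.card G := Subgroup.card_subgroup_dvd_card _
    rw [B.card_mul_index]
    have : Nat.card B * B.relIndex M = Nat.card (B ⊔ M : Subgroup G) := by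
      rw [← e3, ← e1, ← e2]; ring
    rwa [this]
  exact Nat.dvd_of_mul_dvd_mul_left Nat.card_pos e4

lemma relIndex_of_coprime {G : Type*} [Group G] [Finite G] (A B : Subgroup G)
    (h : Nat.Coprime A.index B.index) : B.relIndex A = B.index := by
  have h1 : B.relIndex A * A.index = (A ⊓ B).index := by
    rw [← Subgroup.inf_relIndex_left]; exact Subgroup.relIndex_mul_index inf_le_left
  have h2 : A.relIndex B * B.index = (A ⊓ B).index := by
    rw [← Subgroup.inf_relIndex_right]; exact Subgroup.relIndex_mul_index inf_le_right
  have hd : B.index ∣ B.relIndex A := by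
    have : B.index ∣ B.relIndex A * A.index := by rw [h1, ← h2]; exact dvd_mul_left _ _
    exact h.symm.dvd_of_dvd_mul_right this
  refine le_antisymm ?_ (Nat.le_of_dvd (Nat.pos_of_ne_zero ?_) hd)
  · rw [← Subgroup.relIndex_top_right B]
    exact Subgroup.relIndex_le_of_le_right le_top (by simpa using Subgroup.index_ne_zero_of_finite)
  · exact Subgroup.index_ne_zero_of_finite

lemma mul_of_coprime {G : Type*} [Group G] [Finite G] (A B : Subgroup G)
    (h : Nat.Coprime A.index B.index) (g : G) : ∃ a ∈ A, ∃ b ∈ B, g = b * a := by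
  have h1 := relIndex_of_coprime A B h
  let f : A ⧸ B.subgroupOf A → G ⧸ B := Quotient.map' (fun a => (a : G)) (by
    intro a b hab
    rw [QuotientGroup.leftRel_apply] at hab ⊢
    exact hab)
  have hf : Function.Injective f := by
    intro x y
    induction x using QuotientGroup.induction_on
    induction y using QuotientGroup.induction_on
    intro hxy
    have := QuotientGroup.eq.1 hxy
    exact QuotientGroup.eq.2 this
  have hb : Function.Bijective f := by
    refine (Nat.bijective_iff_injective_and_card f).2 ⟨hf, h1⟩
  obtain ⟨x, hx⟩ := hb.2 ((g⁻¹ : G) : G ⧸ B)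
  induction x using QuotientGroup.induction_on with
  | H a =>
    have := QuotientGroup.eq.1 hx
    refine ⟨(a : G)⁻¹, inv_mem a.2, ((a : G)⁻¹ * g⁻¹)⁻¹, inv_mem this, ?_⟩
    group

lemma normalClosure_le {σ : Set ℕ} {G : Type*} [Group G] [Finite G] (A B : Subgroup G)
    (h : Nat.Coprime A.index B.index) (M : Subgroup A) [M.Normal] (hM : SNum σ (Nat.card M))
    (hB : SNum σᶜ B.index) : Subgroup.normalClosure (M.map A.subtype : Set G) ≤ B := by
  have h1 : (B.subgroupOf A).index = B.index := relIndex_of_coprime A B h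
  have h2 : M ≤ B.subgroupOf A := by
    rw [← Subgroup.relIndex_eq_one]
    refine SNum.eq_one (σ := σ) (hM.dvd (Subgroup.relIndex_dvd_card _ _)) (hB.dvd ?_)
    rw [← h1]
    exact relIndex_dvd_index_of_right_normal _ _
  rw [Subgroup.normalClosure, Subgroup.closure_le]
  intro x hx
  obtain ⟨y, hy, hxy⟩ := Group.mem_conjugatesOfSet_iff.1 hx
  obtain ⟨m, hm, rfl⟩ := hy
  obtain ⟨g, rfl⟩ := isConj_iff.1 hxy
  obtain ⟨a, ha, b, hb, rfl⟩ := mul_of_coprime A B h g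
  have h3 : (⟨a, ha⟩ : A) * m * (⟨a, ha⟩ : A)⁻¹ ∈ M := Subgroup.Normal.conj_mem ‹_› m hm _
  have h4 : a * (m : G) * a⁻¹ ∈ B := h2 h3
  have h5 := B.mul_mem (B.mul_mem hb h4) (B.inv_mem hb)
  have : b * a * A.subtype m * (b * a)⁻¹ = b * (a * (m : G) * a⁻¹) * b⁻¹ := by
    simp only [Subgroup.coe_subtype]; group
  rw [SetLike.mem_coe, this]
  exact h5

lemma core {π : Set ℕ} : ∀ (n : ℕ) {G : Type*} [Group G] [Finite G], Nat.card G = n →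
    (∀ p : ℕ, p.Prime → p ∣ Nat.card G → ∃ T : Subgroup G, PiSeparable π T ∧ ∃ k, T.index = p ^ k) →
    PiSeparable π G := by
  intro n
  induction n using Nat.strong_induction_on with
  | _ n ih =>
    intro G _ _ hn hT
    -- reduction step
    have step : ∀ L : Subgroup G, L.Normal → L ≠ ⊥ → PiSeparable π L → PiSeparable π G := by
      intro L hL hLb hLs
      have h1 : 1 < Nat.card L := (Subgroup.one_lt_card_iff_ne_bot L).2 hLb
      have h2 : 0 < L.index := Nat.pos_of_ne_zero Subgroup.index_ne_zero_of_finite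
      have h3 := L.index_mul_card
      have h4 : Nat.card (G ⧸ L) = L.index := rfl
      refine piSep_ext _ L rfl hLs (ih _ ?_ rfl ?_)
      · nlinarith
      · intro p hp hd
        rw [h4] at hd
        obtain ⟨T, hTs, k, hk⟩ := hT p hp (hd.trans (Dvd.intro _ h3))
        refine ⟨T.map (QuotientGroup.mk' L), ?_, ?_⟩
        · exact piSep_of_surjective ((QuotientGroup.mk' L).subgroupMap T)
            (MonoidHom.subgroupMap_surjective _ _) hTs
        · have := Subgroup.index_map_dvd (f := QuotientGroup.mk' L) T (QuotientGroup.mk'_surjective L)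
          rw [hk] at this
          obtain ⟨j, -, hj⟩ := (Nat.dvd_prime_pow hp).1 this
          exact ⟨j, hj⟩
    -- three primes
    have three : ∀ (σ : Set ℕ), Side π σ → Side π σᶜ → ∀ r s t : ℕ, r.Prime → s.Prime → t.Prime →
        r ∣ Nat.card G → s ∣ Nat.card G → t ∣ Nat.card G → r ≠ s → r ∈ σ → s ∈ σ → t ∉ σ →
        PiSeparable π G := by
      intro σ hσ hσ' r s t hr hs ht hrd hsd htd hrs hrσ hsσ htσ
      obtain ⟨A, hA, k, hk⟩ := hT r hr hrd
      have finish : ∀ τ : Set ℕ, ∀ q : ℕ, q.Prime → q ∣ Nat.card G → q ≠ r → q ∈ τᶜ →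
          ∀ M : Subgroup A, M.Normal → M ≠ ⊥ → SNum τ (Nat.card M) → PiSeparable π G := by
        intro τ q hq hqd hqr hqτ M hM hMb hMs
        obtain ⟨B, hB, j, hj⟩ := hT q hq hqd
        have hle := normalClosure_le A B (by
          rw [hk, hj]
          exact Nat.Coprime.pow _ _ ((Nat.coprime_primes hr hq).2 hqr.symm)) M hMs
          (by rw [hj]; exact SNum.pow hq hqτ)
        refine step (Subgroup.normalClosure (M.map A.subtype : Set G)) inferInstance ?_ ?_
        · intro h
          have h1 : M.map A.subtype ≤ ⊥ := h ▸ Subgroup.subset_normalClosure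
          rw [le_bot_iff, Subgroup.map_eq_bot_iff_of_injective _ A.subtype_injective] at h1
          exact hMb h1
        · exact piSep_of_injective (Subgroup.inclusion hle) (Subgroup.inclusion_injective hle) hB
      by_cases hAb : A = ⊥
      · rw [hAb, Subgroup.index_bot] at hk
        rw [hk] at hsd
        exact absurd ((Nat.prime_dvd_prime_iff_eq hs hr).1 (hs.dvd_of_dvd_pow hsd)) hrs.symm
      have : Nontrivial A := (Subgroup.nontrivial_iff_ne_bot A).2 hAb
      obtain ⟨τ, hτ, M, hM, hMb, hMs⟩ := exists_normal hA
      have hτ2 : τ = σ ∨ τ = σᶜ := by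
        rcases hτ with rfl | rfl <;> rcases hσ with rfl | rfl <;> simp
      rcases hτ2 with rfl | rfl
      · exact finish _ t ht htd (fun h => htσ (h ▸ hrσ)) htσ M hM hMb hMs
      · exact finish _ s hs hsd hrs.symm (by simpa using hsσ) M hM hMb hMs
    by_cases hc1 : SNum π (Nat.card G)
    · exact piSep_of_snum (Or.inl rfl) hc1
    by_cases hc2 : SNum πᶜ (Nat.card G)
    · exact piSep_of_snum (Or.inr rfl) hc2
    simp only [SNum, not_forall] at hc1 hc2
    obtain ⟨p, hp, hpd, hpπ⟩ := hc1
    obtain ⟨q, hq, hqd, hqπ⟩ := hc2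
    have hqπ' : q ∈ π := by simpa using hqπ
    by_cases hpq : ∀ r : ℕ, r.Prime → r ∣ Nat.card G → r = p ∨ r = q
    · exact piSep_two hp hq _ rfl hpq
    push Not at hpq
    obtain ⟨r, hr, hrd, hrp, hrq⟩ := hpq
    by_cases hrπ : r ∈ π
    · exact three π (Or.inl rfl) (Or.inr rfl) r q p hr hq hp hrd hqd hpd hrq hrπ hqπ' hpπ
    · exact three πᶜ (Or.inr rfl) (Or.inl (by simp)) r p q hr hp hq hrd hpd hqd hrp hrπ hpπ hqπ

end PiSepAux

/-- If every maximal subgroup of every Sylow subgroup of a finite group `G` has a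
`π`-separable supplement in `G`, then `G` is `π`-separable. -/
theorem pi_separable_of_supplements (π : Set ℕ) (G : Type*) [Group G] [Finite G]
    (hsupp : ∀ p : ℕ, p.Prime → p ∣ Nat.card G →
      ∀ (P : Sylow p G) (V : Subgroup G), V < ↑P →
        (∀ W : Subgroup G, V < W → W ≤ ↑P → W = ↑P) →
        ∃ T : Subgroup G, (V : Set G) * (T : Set G) = Set.univ ∧ PiSeparable π ↥T) :
    PiSeparable π G := by
  refine PiSepAux.core _ rfl ?_
  intro p hp hd
  have : Fact p.Prime := ⟨hp⟩
  obtain ⟨P⟩ : Nonempty (Sylow p G) := inferInstance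
  have hPb : (⊥ : Subgroup G) < ↑P := bot_lt_iff_ne_bot.2 (P.ne_bot_of_dvd_card hd)
  obtain ⟨V, -, hV⟩ := (Set.toFinite {V : Subgroup G | V < ↑P}).exists_le_maximal
    (show ⊥ ∈ _ from hPb)
  obtain ⟨T, hVT, hT⟩ := hsupp p hp hd P V hV.prop (by
    intro W hVW hWP
    by_contra hne
    exact absurd (hV.le_of_ge (lt_of_le_of_ne hWP hne) hVW.le) (not_le_of_gt hVW))
  refine ⟨T, hT, ?_⟩
  have hVp : IsPGroup p V := P.2.to_le hV.prop.le
  obtain ⟨m, hm⟩ := IsPGroup.iff_card.1 hVp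
  have : T.index ∣ p ^ m := by
    rw [← hm]
    let f : V ⧸ T.subgroupOf V → G ⧸ T := Quotient.map' (fun a => (a : G)) (by
      intro a b hab
      rw [QuotientGroup.leftRel_apply] at hab ⊢
      exact hab)
    have hf : Function.Bijective f := by
      constructor
      · intro x y
        induction x using QuotientGroup.induction_on
        induction y using QuotientGroup.induction_on
        intro hxy
        have := QuotientGroup.eq.1 hxy
        exact QuotientGroup.eq.2 this
      · intro x
        induction x using QuotientGroup.induction_on with
        | H g =>
          have hg : g ∈ (V : Set G) * (T : Set G) := hVT ▸ Set.mem_univ g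
          obtain ⟨v, hv, t, ht, rfl⟩ := Set.mem_mul.1 hg
          refine ⟨((⟨v, hv⟩ : V) : V ⧸ T.subgroupOf V), QuotientGroup.eq.2 ?_⟩
          simpa using ht
    have he : T.index = T.relIndex V := (Nat.card_eq_of_bijective f hf).symm
    rw [he]
    exact Subgroup.relIndex_dvd_card _ _
  obtain ⟨j, -, hj⟩ := (Nat.dvd_prime_pow hp).1 this
  exact ⟨j, hj⟩
end

section
/- Let G be a finite group and σ a partition of the set of all primes. Then G is σ-soluble if and only if for every prime p dividing |G|, every Sylow p-subgroup P of G, and every maximal subgroup V of P, there exists a σ-soluble subgroup T of G with VT = G. -/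
open scoped Pointwise

/-- `σ` is a partition of the set of all primes: each class is nonempty, the
classes are pairwise disjoint, and their union is the set of all primes. -/
def SigmaPartition {ι : Type*} (σ : ι → Set ℕ) : Prop :=
  (∀ i, (σ i).Nonempty) ∧ (Pairwise fun i j => Disjoint (σ i) (σ j)) ∧
    (⋃ i, σ i) = {p : ℕ | p.Prime}

/-- A group is `σ`-primary if all primes dividing its order lie in a single class `σ i`. -/
def SigmaPrimary {ι : Type*} (σ : ι → Set ℕ) (G : Type*) [Group G] : Prop :=
  ∃ i, ∀ p : ℕ, p.Prime → p ∣ Nat.card G → p ∈ σ i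

/-- A group is `σ`-soluble if it has a normal series all of whose factors are
`σ`-primary (the order of the factor `c k.succ / c k.castSucc` is the index
`((c k.castSucc).subgroupOf (c k.succ)).index`). -/
def SigmaSoluble {ι : Type*} (σ : ι → Set ℕ) (G : Type*) [Group G] : Prop :=
  ∃ (n : ℕ) (c : Fin (n + 1) → Subgroup G),
    c 0 = ⊥ ∧ c (Fin.last n) = ⊤ ∧ Monotone c ∧ (∀ k, (c k).Normal) ∧
    ∀ k : Fin n, ∃ i, ∀ p : ℕ, p.Prime →
      p ∣ ((c k.castSucc).subgroupOf (c k.succ)).index → p ∈ σ i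

/-- A group is `σ`-nilpotent if it is the (internal) direct product of finitely many
`σ`-primary (normal) subgroups. -/
def SigmaNilpotent {ι : Type*} (σ : ι → Set ℕ) (G : Type*) [Group G] : Prop :=
  ∃ (n : ℕ) (H : Fin n → Subgroup G),
    (∀ k, (H k).Normal) ∧ iSupIndep H ∧ (⨆ k, H k) = ⊤ ∧
    ∀ k, ∃ i, ∀ p : ℕ, p.Prime → p ∣ Nat.card (H k) → p ∈ σ i

/-- A Hall `ρ`-subgroup: all primes dividing its order lie in `ρ`, and no prime
dividing its index lies in `ρ`. -/
def IsHallSubgroup {G : Type*} [Group G] (ρ : Set ℕ) (H : Subgroup G) : Prop :=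
  (∀ p : ℕ, p.Prime → p ∣ Nat.card H → p ∈ ρ) ∧
  (∀ p : ℕ, p.Prime → p ∣ H.index → p ∉ ρ)

/-- A Hall `σ i`-subgroup of `G`. -/
def IsHallSigmaSubgroup {ι : Type*} (σ : ι → Set ℕ) {G : Type*} [Group G]
    (i : ι) (H : Subgroup G) : Prop :=
  IsHallSubgroup (σ i) H

/-- A complete Hall `σ`-set of `G`: every nontrivial member is a Hall
`σ i`-subgroup for some `i`, and for every `i` with `σ i ∩ π(G) ≠ ∅` the set
contains exactly one Hall `σ i`-subgroup of `G`. -/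
def CompleteHallSigmaSet {ι : Type*} (σ : ι → Set ℕ) (G : Type*) [Group G]
    (ℋ : Set (Subgroup G)) : Prop :=
  (∀ H ∈ ℋ, H ≠ ⊥ → ∃ i, IsHallSigmaSubgroup σ i H) ∧
  ∀ i, (∃ p : ℕ, p.Prime ∧ p ∈ σ i ∧ p ∣ Nat.card G) →
    ∃! H : Subgroup G, H ∈ ℋ ∧ IsHallSigmaSubgroup σ i H

/-- A subgroup `A` is `σ`-permutable in `G` if `G` has a complete Hall `σ`-set `ℋ`
with `A Hˣ = Hˣ A` for all `H ∈ ℋ` and all `x ∈ G`. -/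
def SigmaPermutable {ι : Type*} (σ : ι → Set ℕ) {G : Type*} [Group G]
    (A : Subgroup G) : Prop :=
  ∃ ℋ : Set (Subgroup G), CompleteHallSigmaSet σ G ℋ ∧
    ∀ H ∈ ℋ, ∀ x : G,
      (A : Set G) * (H.map (MulAut.conj x).toMonoidHom : Set G) =
        (H.map (MulAut.conj x).toMonoidHom : Set G) * (A : Set G)

/-- `G` is a `PσT`-group: `σ`-permutability is transitive, i.e. if `H` is
`σ`-permutable in `G` and `K` is `σ`-permutable in `H`, then `K` is
`σ`-permutable in `G`. -/
def IsPSigmaT {ι : Type*} (σ : ι → Set ℕ) (G : Type*) [Group G] : Prop :=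
  ∀ H : Subgroup G, SigmaPermutable σ H →
    ∀ K : Subgroup ↥H, SigmaPermutable σ K →
      SigmaPermutable σ (K.map H.subtype)


theorem ss_avg_roots (N : ℕ) (hN : 0 < N) (s : Multiset ℂ) (hs : ∀ z ∈ s, z ^ N = 1)
    (n : ℕ) (hn : 0 < n) (hcard : Multiset.card s = n) (α : ℂ) (hα : (n : ℂ) * α = s.sum)
    (hintg : IsIntegral ℤ α) (h0 : α ≠ 0) : ∀ z ∈ s, z = α := by
  classical
  have hnC : (n : ℂ) ≠ 0 := by exact_mod_cast hn.ne'
  let K := IntermediateField.adjoin ℚ (s.toFinset : Set ℂ)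
  have hfd : FiniteDimensional ℚ K := by
    apply IntermediateField.finiteDimensional_adjoin
    intro x hx
    have hx' : x ∈ s := by simpa using hx
    exact IsIntegral.of_pow hN (by rw [hs x hx']; exact isIntegral_one)
  have : NumberField K := { to_charZero := inferInstance, to_finiteDimensional := hfd }
  have hmem : ∀ z ∈ s, z ∈ K := fun z hz =>
    IntermediateField.subset_adjoin ℚ _ (by simpa using hz)
  have hsum : s.sum ∈ K := multiset_sum_mem _ hmem
  have hαe : α = s.sum / n := by field_simp; rw [← hα]; ring
  have hαK : α ∈ K := by
    rw [hαe]; exact div_mem hsum (natCast_mem K n)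
  have hnorm : ∀ z : ℂ, z ^ N = 1 → ‖z‖ = 1 := fun z hz =>
    Complex.norm_eq_one_of_pow_eq_one hz hN.ne'
  obtain ⟨t, ht⟩ : ∃ t : Multiset K, t.map (algebraMap K ℂ) = s := by
    refine ⟨s.attach.map (fun z => ⟨z.1, hmem z.1 z.2⟩), ?_⟩
    rw [Multiset.map_map]
    exact Multiset.attach_map_val s
  have hbound : ∀ φ : K →+* ℂ, ‖φ ⟨α, hαK⟩‖ ≤ 1 := by
    intro φ
    have e1 : (n : K) * ⟨α, hαK⟩ = t.sum := by
      apply (algebraMap K ℂ).injective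
      rw [map_mul, map_multiset_sum, ht, map_natCast, ← hα]; rfl
    have e2 : (n : ℂ) * φ ⟨α, hαK⟩ = (t.map φ).sum := by
      rw [← map_multiset_sum, ← e1, map_mul, map_natCast]
    have e3 : ‖(t.map φ).sum‖ ≤ n := by
      have hc : Multiset.card t = n := by rw [← hcard, ← ht, Multiset.card_map]
      refine (norm_multiset_sum_le _).trans ?_
      rw [Multiset.map_map]
      have : ∀ x ∈ t, (norm ∘ φ) x = (1 : ℝ) := by
        intro x hx
        apply hnorm
        rw [← map_pow]
        have : x ^ N = 1 := by
          apply (algebraMap K ℂ).injective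
          rw [map_pow, map_one]
          apply hs
          rw [← ht]
          exact Multiset.mem_map_of_mem _ hx
        rw [this, map_one]
      rw [Multiset.map_congr rfl this]
      simp [hc]
    rw [← e2, norm_mul, Complex.norm_natCast] at e3
    have : (0 : ℝ) < n := by exact_mod_cast hn
    by_contra hcon
    push Not at hcon
    nlinarith
  obtain ⟨k, hk, hpow⟩ := NumberField.Embeddings.pow_eq_one_of_norm_le_one (K := K) (A := ℂ)
    (x := ⟨α, hαK⟩) (by intro h; exact h0 (congrArg Subtype.val h))
    ((isIntegral_algebraMap_iff (A := K) (B := ℂ) (algebraMap K ℂ).injective).1 hintg) hbound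
  have hα1 : ‖α‖ = 1 := Complex.norm_eq_one_of_pow_eq_one
    (by simpa using congrArg Subtype.val hpow) hk.ne'
  have hcc : α * (starRingEnd ℂ) α = 1 := by
    rw [Complex.mul_conj, Complex.normSq_eq_norm_sq, hα1]; simp
  have key : ∀ z ∈ s, (z * (starRingEnd ℂ) α).re = 1 := by
    by_contra hcon
    push Not at hcon
    obtain ⟨z, hz, hz1⟩ := hcon
    have hle : ∀ z ∈ s, (z * (starRingEnd ℂ) α).re ≤ 1 := by
      intro z hz
      refine (Complex.re_le_norm _).trans ?_
      rw [norm_mul, hnorm z (hs z hz), RCLike.norm_conj, hα1, one_mul]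
    have hlt := Multiset.sum_lt_sum (s := s) (f := fun z => (z * (starRingEnd ℂ) α).re)
      (g := fun _ => (1 : ℝ)) hle ⟨z, hz, lt_of_le_of_ne (hle z hz) hz1⟩
    have e : (s.map fun z => (z * (starRingEnd ℂ) α).re).sum = n := by
      have : (s.map fun z => (z * (starRingEnd ℂ) α).re).sum
          = ((s.map fun z => (z * (starRingEnd ℂ) α)).sum).re := by
        refine Eq.trans ?_ (map_multiset_sum Complex.reLm _).symm
        rw [Multiset.map_map]; rfl
      rw [this, Multiset.sum_map_mul_right, Multiset.map_id', ← hα, mul_assoc, hcc]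
      simp
    rw [e] at hlt
    simp [hcard] at hlt
  intro z hz
  have h1 := key z hz
  have h2 : ‖z * (starRingEnd ℂ) α‖ = 1 := by
    rw [norm_mul, hnorm z (hs z hz), RCLike.norm_conj, hα1, one_mul]
  have h3 : z * (starRingEnd ℂ) α = 1 := by
    have h4 : (z * (starRingEnd ℂ) α).re ^ 2 + (z * (starRingEnd ℂ) α).im ^ 2 = 1 := by
      have := Complex.sq_norm (z * (starRingEnd ℂ) α)
      rw [h2, Complex.normSq_apply] at this
      linarith
    apply Complex.ext
    · simpa using h1
    · rw [h1] at h4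
      have : (z * (starRingEnd ℂ) α).im ^ 2 = 0 := by linarith
      simpa using this
  calc z = z * (α * (starRingEnd ℂ) α) := by rw [hcc, mul_one]
    _ = (z * (starRingEnd ℂ) α) * α := by ring
    _ = α := by rw [h3, one_mul]

theorem ss_matrix_eig (n : ℕ) (A : Matrix (Fin n) (Fin n) ℂ) (N : ℕ) (hA : A ^ N = 1) :
    ∀ z ∈ A.charpoly.roots, z ^ N = 1 := by
  intro z hz
  have hz' : z ∈ spectrum ℂ A := by
    rw [Matrix.mem_spectrum_iff_isRoot_charpoly]
    exact Polynomial.isRoot_of_mem_roots hz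
  have hne : Nontrivial (Matrix (Fin n) (Fin n) ℂ) := by
    by_contra h
    rw [not_nontrivial_iff_subsingleton] at h
    simp [spectrum.of_subsingleton] at hz'
  have := spectrum.pow_mem_pow A N hz'
  rw [hA, spectrum.one_eq] at this
  simpa using this

theorem ss_trace_integral (n : ℕ) (A : Matrix (Fin n) (Fin n) ℂ) (N : ℕ) (hN : 0 < N)
    (hA : A ^ N = 1) : IsIntegral ℤ A.trace := by
  rw [Matrix.trace_eq_sum_roots_charpoly]
  refine IsIntegral.multiset_sum fun z hz => ?_
  exact IsIntegral.of_pow hN (by rw [ss_matrix_eig n A N hA z hz]; exact isIntegral_one)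

theorem ss_scalar_of_eig (n : ℕ) (A : Matrix (Fin n) (Fin n) ℂ) (N : ℕ) (hN : 0 < N)
    (hA : A ^ N = 1) (α : ℂ) (hα : α ^ N = 1) (h : ∀ z ∈ A.charpoly.roots, z = α) :
    A = α • (1 : Matrix (Fin n) (Fin n) ℂ) := by
  open Polynomial in
  have hsplit : A.charpoly.Splits := IsAlgClosed.splits _
  have hch : A.charpoly = (X - C α) ^ n := by
    have h1 := hsplit.eq_prod_roots_of_monic (Matrix.charpoly_monic A)
    have h2 : A.charpoly.roots = Multiset.replicate n α := by
      rw [Multiset.eq_replicate]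
      refine ⟨?_, h⟩
      rw [← hsplit.natDegree_eq_card_roots, Matrix.charpoly_natDegree_eq_dim, Fintype.card_fin]
    rw [h2] at h1
    simpa using h1
  have hsep : (X ^ N - 1 : ℂ[X]).Separable :=
    (Polynomial.X_pow_sub_one_separable_iff).2 (by exact_mod_cast hN.ne')
  obtain ⟨h', hh⟩ : (X - C α) ∣ (X ^ N - 1 : ℂ[X]) := by
    rw [dvd_iff_isRoot]; simp [hα]
  rw [hh] at hsep
  obtain ⟨u, v, huv⟩ := (hsep.isCoprime.pow_left (m := n))
  have e1 : aeval A ((X - C α) ^ n) = 0 := by rw [← hch]; exact Matrix.aeval_self_charpoly A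
  have e2 : aeval A ((X - C α) * h') = 0 := by rw [← hh]; simp [hA]
  have e3 : (X - C α : ℂ[X]) = u * (X - C α) * (X - C α) ^ n + v * ((X - C α) * h') := by
    calc (X - C α : ℂ[X]) = (X - C α) * (u * (X - C α) ^ n + v * h') := by rw [huv, mul_one]
      _ = _ := by ring
  have e4 : aeval A (X - C α) = 0 := by
    rw [e3, map_add, map_mul _ _ ((X - C α) ^ n), map_mul _ v, e1, e2]; simp
  rw [map_sub, aeval_X, aeval_C, sub_eq_zero, Algebra.algebraMap_eq_smul_one] at e4
  exact e4

theorem ss_char_lemma {G : Type*} [Group G] [Finite G] (n : ℕ) (hn : 0 < n)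
    (ρ : G →* Matrix (Fin n) (Fin n) ℂ)
    (hirr : ∀ A, (∀ h, A * ρ h = ρ h * A) → ∃ c : ℂ, A = c • 1) (g : G)
    (hco : Nat.Coprime (Nat.card (conjugatesOf g)) n) :
    (ρ g).trace = 0 ∨ ∃ c : ℂ, ρ g = c • 1 := by
  classical
  have := Fintype.ofFinite G
  have : NeZero n := ⟨hn.ne'⟩
  let S : Finset G := (conjugatesOf g).toFinset
  have hS : ∀ x, x ∈ S ↔ IsConj g x := fun x => by simp only [S, Set.mem_toFinset]; rfl
  have hScard : S.card = Nat.card (conjugatesOf g) := by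
    rw [Nat.card_eq_card_toFinset]
  let K : Matrix (Fin n) (Fin n) ℂ := ∑ x ∈ S, ρ x
  have hKint : IsIntegral ℤ K := by
    have h1 : IsIntegral ℤ (∑ x ∈ S, MonoidAlgebra.of ℤ G x) := IsIntegral.of_finite ℤ _
    have h2 := h1.map (MonoidAlgebra.lift ℤ _ G ρ)
    rw [map_sum] at h2
    simpa only [MonoidAlgebra.lift_of] using h2
  obtain ⟨ω, hω⟩ := hirr K (by
    intro h
    simp only [K, Finset.sum_mul, Finset.mul_sum, ← map_mul]
    refine Finset.sum_bij (fun x _ => h⁻¹ * x * h) ?_ ?_ ?_ ?_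
    · intro a ha
      rw [hS] at ha ⊢
      exact ha.trans (isConj_iff.2 ⟨h⁻¹, by simp⟩)
    · intro a _ b _ hab
      simpa using hab
    · intro b hb
      refine ⟨h * b * h⁻¹, ?_, by group⟩
      rw [hS] at hb ⊢
      exact hb.trans (isConj_iff.2 ⟨h, rfl⟩)
    · intro a _
      congr 1
      group)
  have hωint : IsIntegral ℤ ω := by
    rw [hω, ← Algebra.algebraMap_eq_smul_one] at hKint
    exact (isIntegral_algebraMap_iff (FaithfulSMul.algebraMap_injective ℂ _)).1 hKint
  have htr : (S.card : ℂ) * (ρ g).trace = n * ω := by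
    have h1 : K.trace = S.card * (ρ g).trace := by
      simp only [K, Matrix.trace_sum]
      rw [Finset.sum_congr rfl (g := fun _ => (ρ g).trace)]
      · simp
      · intro x hx
        rw [hS, isConj_iff] at hx
        obtain ⟨c, rfl⟩ := hx
        rw [map_mul, Matrix.trace_mul_comm, ← map_mul]
        congr 2
        group
    rw [← h1, hω, Matrix.trace_smul, Matrix.trace_one]
    simp [mul_comm]
  set N := orderOf g with hNdef
  have hN : 0 < N := orderOf_pos g
  have hA : ρ g ^ N = 1 := by rw [← map_pow, pow_orderOf_eq_one, map_one]
  have hnC : (n : ℂ) ≠ 0 := by exact_mod_cast hn.ne'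
  by_cases h0 : (ρ g).trace = 0
  · exact Or.inl h0
  right
  have hintg : IsIntegral ℤ ((ρ g).trace / n) := by
    have hb := Nat.gcd_eq_gcd_ab S.card n
    rw [hScard, hco.gcd_eq_one, ← hScard] at hb
    set a := Nat.gcdA S.card n
    set b := Nat.gcdB S.card n
    have hb' : (1 : ℂ) = S.card * a + n * b := by exact_mod_cast hb
    have : (ρ g).trace / n = a * ω + b * (ρ g).trace := by
      field_simp
      calc (ρ g).trace = (S.card * a + n * b) * (ρ g).trace := by rw [← hb', one_mul]
        _ = a * (S.card * (ρ g).trace) + n * b * (ρ g).trace := by ring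
        _ = _ := by rw [htr]; ring
    rw [this]
    have hz : ∀ a : ℤ, IsIntegral ℤ (a : ℂ) := fun a => isIntegral_algebraMap (x := a)
    exact ((hz a).mul hωint).add ((hz b).mul (ss_trace_integral n _ N hN hA))
  have hsplit : (ρ g).charpoly.Splits := IsAlgClosed.splits _
  have hcard : Multiset.card (ρ g).charpoly.roots = n := by
    rw [← hsplit.natDegree_eq_card_roots, Matrix.charpoly_natDegree_eq_dim, Fintype.card_fin]
  have hall := ss_avg_roots N hN (ρ g).charpoly.roots (ss_matrix_eig n _ N hA) n hn hcard
    ((ρ g).trace / n) (by rw [← Matrix.trace_eq_sum_roots_charpoly]; field_simp) hintg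
    (div_ne_zero h0 hnC)
  refine ⟨(ρ g).trace / n, ss_scalar_of_eig n _ N hN hA _ ?_ hall⟩
  obtain ⟨z, hz⟩ : ∃ z, z ∈ (ρ g).charpoly.roots := by
    rw [← Multiset.card_pos_iff_exists_mem, hcard]; exact hn
  rw [← hall z hz]
  exact ss_matrix_eig n _ N hA z hz

theorem ss_trace_pi (m : ℕ) (d : Fin m → ℕ) (y : Π i, Matrix (Fin (d i)) (Fin (d i)) ℂ) :
    LinearMap.trace ℂ _ (LinearMap.mulLeft ℂ y) = ∑ i, (d i : ℂ) * (y i).trace := by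
  classical
  let b := Pi.basis (fun i => Matrix.stdBasis ℂ (Fin (d i)) (Fin (d i)))
  rw [LinearMap.trace_eq_matrix_trace ℂ b, Matrix.trace, Fintype.sum_sigma]
  refine Finset.sum_congr rfl fun i _ => ?_
  rw [Fintype.sum_prod_type]
  have : ∀ a c : Fin (d i), (LinearMap.toMatrix b b (LinearMap.mulLeft ℂ y)).diag ⟨i, (a, c)⟩
      = y i a a := by
    intro a c
    rw [Matrix.diag_apply, LinearMap.toMatrix_apply, LinearMap.mulLeft_apply]
    simp only [b, Pi.basis_repr, Pi.basis_apply, Pi.mul_apply, Pi.single_eq_same]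
    rw [Matrix.stdBasis_eq_single]
    simp [Matrix.stdBasis]
  simp_rw [this]
  simp [Matrix.trace, Finset.mul_sum]

theorem ss_trace_group {G : Type*} [Group G] [Finite G] (g : G) (hg : g ≠ 1) :
    LinearMap.trace ℂ (MonoidAlgebra ℂ G)
      (LinearMap.mulLeft ℂ (MonoidAlgebra.of ℂ G g)) = 0 := by
  classical
  have := Fintype.ofFinite G
  let b : Module.Basis G ℂ (MonoidAlgebra ℂ G) := MonoidAlgebra.basis G ℂ 
  rw [LinearMap.trace_eq_matrix_trace ℂ b, Matrix.trace]
  refine Finset.sum_eq_zero fun x _ => ?_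
  rw [Matrix.diag_apply, LinearMap.toMatrix_apply, LinearMap.mulLeft_apply]
  have : MonoidAlgebra.of ℂ G g * b x = b (g * x) := by simp [b]
  rw [this, Module.Basis.repr_self, Finsupp.single_apply, if_neg]
  simpa using hg

theorem ss_not_integral (p : ℕ) (hp : p.Prime) (β : ℂ) (hβ : IsIntegral ℤ β)
    (h : 1 + (p : ℂ) * β = 0) : False := by
  have hp0 : (p : ℂ) ≠ 0 := by exact_mod_cast hp.ne_zero
  have e : β = algebraMap ℚ ℂ (-1 / p) := by
    simp only [map_div₀, map_neg, map_one, map_natCast]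
    field_simp
    linear_combination h
  rw [e, isIntegral_algebraMap_iff (algebraMap ℚ ℂ).injective,
    IsIntegrallyClosed.isIntegral_iff] at hβ
  obtain ⟨y, hy⟩ := hβ
  have hp0' : (p : ℚ) ≠ 0 := by exact_mod_cast hp.ne_zero
  rw [eq_div_iff hp0'] at hy
  rw [eq_intCast] at hy
  have hy' : y * (p : ℤ) = -1 := by exact_mod_cast hy
  have : (p : ℤ) ∣ 1 := ⟨-y, by linarith⟩
  have := Int.natCast_dvd_natCast.1 (by simpa using this : (p : ℤ) ∣ ((1 : ℕ) : ℤ))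
  exact hp.one_lt.ne' (Nat.dvd_one.1 this)

/-- Burnside: in a finite simple group with trivial center no nontrivial element has a
conjugacy class of prime power size. -/
theorem ss_burnside_class {G : Type*} [Group G] [Finite G] [IsSimpleGroup G]
    (hc : Subgroup.center G = ⊥) (g : G) (hg : g ≠ 1) (p : ℕ) (hp : p.Prime) (a : ℕ)
    (hcard : Nat.card (conjugatesOf g) = p ^ a) : False := by
  classical
  have := Fintype.ofFinite G
  have : NeZero (Nat.card G : ℂ) := ⟨by exact_mod_cast Nat.card_pos.ne'⟩
  obtain ⟨m, d, hd, ⟨e⟩⟩ :=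
    IsSemisimpleRing.exists_algEquiv_pi_matrix_of_isAlgClosed ℂ (MonoidAlgebra ℂ G)
  let ρ : ∀ i, G →* Matrix (Fin (d i)) (Fin (d i)) ℂ := fun i =>
    ((Pi.evalMonoidHom (fun i => Matrix (Fin (d i)) (Fin (d i)) ℂ) i).comp
      (e : MonoidAlgebra ℂ G →* Π i, Matrix (Fin (d i)) (Fin (d i)) ℂ)).comp
      (MonoidAlgebra.of ℂ G)
  have hρ : ∀ i h, ρ i h = e (MonoidAlgebra.of ℂ G h) i := fun i h => rfl
  -- Schur
  have hirr : ∀ i, ∀ A, (∀ h, A * ρ i h = ρ i h * A) → ∃ c : ℂ, A = c • 1 := by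
    intro i A hA
    have h1 : ∀ x : MonoidAlgebra ℂ G, A * e x i = e x i * A := by
      intro x
      induction x using MonoidAlgebra.induction_on with
      | of h => exact hA h
      | add x y hx hy => rw [map_add, Pi.add_apply, mul_add, add_mul, hx, hy]
      | smul r x hx => rw [map_smul, Pi.smul_apply, mul_smul_comm, smul_mul_assoc, hx]
    have h2 : A ∈ Set.center (Matrix (Fin (d i)) (Fin (d i)) ℂ) := by
      rw [Semigroup.mem_center_iff]
      intro B
      have := h1 (e.symm (Pi.single i B))
      simpa using this.symm
    have h3 : A ∈ Subalgebra.center ℂ (Matrix (Fin (d i)) (Fin (d i)) ℂ) := h2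
    rw [Algebra.IsCentral.center_eq_bot, Algebra.mem_bot] at h3
    obtain ⟨c, rfl⟩ := h3
    exact ⟨c, Algebra.algebraMap_eq_smul_one c⟩
  -- the sum of all elements
  let u : MonoidAlgebra ℂ G := ∑ h : G, MonoidAlgebra.of ℂ G h
  have hu : ∀ h, MonoidAlgebra.of ℂ G h * u = u := by
    intro h
    simp only [u, Finset.mul_sum, ← map_mul]
    exact Fintype.sum_equiv (Equiv.mulLeft h) _ _ (fun _ => rfl)
  have hu' : ∀ h, u * MonoidAlgebra.of ℂ G h = u := by
    intro h
    simp only [u, Finset.sum_mul, ← map_mul]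
    exact Fintype.sum_equiv (Equiv.mulRight h) _ _ (fun _ => rfl)
  have hu0 : u ≠ 0 := by
    intro h
    have h1 : MonoidAlgebra.lift ℂ ℂ G (1 : G →* ℂ) u = 0 := by rw [h, map_zero]
    simp only [u, map_sum, MonoidAlgebra.lift_of] at h1
    simp at h1
  obtain ⟨i0, hi0⟩ : ∃ i, e u i ≠ 0 := by
    by_contra hcon
    push Not at hcon
    exact hu0 (e.injective (by rw [map_zero]; exact funext hcon))
  have htriv0 : ∀ h, ρ i0 h = 1 := by
    intro h
    obtain ⟨c, hc⟩ := hirr i0 (e u i0) (by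
      intro h
      rw [hρ, ← Pi.mul_apply, ← Pi.mul_apply, ← map_mul, ← map_mul, hu, hu'])
    have hc0 : c ≠ 0 := by
      rintro rfl
      exact hi0 (by rw [hc, zero_smul])
    have h1 : ρ i0 h * e u i0 = e u i0 := by
      rw [hρ, ← Pi.mul_apply, ← map_mul, hu]
    rw [hc, mul_smul_comm, mul_one] at h1
    exact smul_right_injective _ hc0 h1
  have hd0 : d i0 = 1 := by
    by_contra hne
    have hpos : 0 < d i0 := Nat.pos_of_ne_zero (hd i0).out
    let x0 : Fin (d i0) := ⟨0, hpos⟩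
    let x1 : Fin (d i0) := ⟨1, by omega⟩
    have hx : x0 ≠ x1 := by simp [x0, x1]
    obtain ⟨c, hc⟩ := hirr i0 (Matrix.single x0 x1 1) (by intro h; rw [htriv0]; simp)
    have := congrFun (congrFun hc x0) x1
    simp [hx] at this
  have huniq : ∀ j, (∀ h, ρ j h = 1) → j = i0 := by
    intro j hj
    by_contra hne
    have h1 : ∀ i, (∀ h, ρ i h = 1) → ∀ x : MonoidAlgebra ℂ G,
        e x i = (MonoidAlgebra.lift ℂ ℂ G (1 : G →* ℂ) x) • 1 := by
      intro i hi x
      induction x using MonoidAlgebra.induction_on with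
      | of h => rw [← hρ, hi, MonoidAlgebra.lift_of]; simp
      | add x y hx hy => rw [map_add, Pi.add_apply, hx, hy, map_add, add_smul]
      | smul r x hx => rw [map_smul, Pi.smul_apply, hx, map_smul, smul_assoc]
    have h2 := h1 j hj (e.symm (Pi.single j 1))
    have h3 := h1 i0 htriv0 (e.symm (Pi.single j 1))
    have : NeZero (d j) := hd j
    have : NeZero (d i0) := hd i0
    rw [AlgEquiv.apply_symm_apply, Pi.single_eq_same] at h2
    rw [AlgEquiv.apply_symm_apply, Pi.single_eq_of_ne (Ne.symm hne)] at h3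
    have h4 := (smul_eq_zero.1 h3.symm).resolve_right one_ne_zero
    rw [h4, zero_smul] at h2
    exact one_ne_zero h2
  -- trace computation
  have hsum : ∑ i, (d i : ℂ) * (ρ i g).trace = 0 := by
    rw [← ss_trace_group g hg, ← LinearMap.trace_conj' _ e.toLinearEquiv]
    have : (e.toLinearEquiv.conj (LinearMap.mulLeft ℂ (MonoidAlgebra.of ℂ G g)))
        = LinearMap.mulLeft ℂ (e (MonoidAlgebra.of ℂ G g)) := by
      refine LinearMap.ext fun y => ?_
      rw [LinearEquiv.conj_apply_apply, LinearMap.mulLeft_apply, LinearMap.mulLeft_apply]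
      change e (_ * e.symm y) = _
      rw [map_mul, AlgEquiv.apply_symm_apply]
    rw [this, ss_trace_pi]
    rfl
  have hother : ∀ i, i ≠ i0 → ∃ β : ℂ, IsIntegral ℤ β ∧ (d i : ℂ) * (ρ i g).trace = p * β := by
    intro i hi
    have hNpos : 0 < orderOf g := orderOf_pos g
    have hpw : ρ i g ^ orderOf g = 1 := by rw [← map_pow, pow_orderOf_eq_one, map_one]
    have htri := ss_trace_integral (d i) (ρ i g) (orderOf g) hNpos hpw
    have hz : ∀ a : ℕ, IsIntegral ℤ (a : ℂ) := fun a => by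
      simpa using isIntegral_algebraMap (R := ℤ) (A := ℂ) (x := (a : ℤ))
    by_cases hpd : p ∣ d i
    · obtain ⟨k, hk⟩ := hpd
      refine ⟨k * (ρ i g).trace, (hz k).mul htri, ?_⟩
      have hk' : (d i : ℂ) = p * k := by exact_mod_cast hk
      rw [← mul_assoc, ← hk']
    · have hco : Nat.Coprime (Nat.card (conjugatesOf g)) (d i) := by
        rw [hcard]
        exact Nat.Coprime.pow_left _ ((Nat.Prime.coprime_iff_not_dvd hp).2 hpd)
      rcases ss_char_lemma (d i) (Nat.pos_of_ne_zero (hd i).out) (ρ i) (hirr i) g hco with h | h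
      · exact ⟨0, isIntegral_zero, by rw [h]; ring⟩
      · exfalso
        obtain ⟨c, hcc⟩ := h
        rcases (inferInstance : (ρ i).ker.Normal).eq_bot_or_eq_top with hk | hk
        · have hinj := (MonoidHom.ker_eq_bot_iff _).1 hk
          have : g ∈ Subgroup.center G := by
            rw [Subgroup.mem_center_iff]
            intro h
            apply hinj
            rw [map_mul, map_mul, hcc]
            simp
          rw [hc, Subgroup.mem_bot] at this
          exact hg this
        · apply hi
          apply huniq
          intro h
          have : h ∈ (ρ i).ker := by rw [hk]; trivial
          exact this
  have hother' : ∀ i, ∃ β : ℂ, IsIntegral ℤ β ∧ (i ≠ i0 → (d i : ℂ) * (ρ i g).trace = p * β) := by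
    intro i
    by_cases hi : i = i0
    · exact ⟨0, isIntegral_zero, fun h => absurd hi h⟩
    · obtain ⟨β, h1, h2⟩ := hother i hi
      exact ⟨β, h1, fun _ => h2⟩
  choose β hβ1 hβ2 using hother'
  rw [← Finset.add_sum_erase _ _ (Finset.mem_univ i0)] at hsum
  rw [Finset.sum_congr rfl (g := fun i => (p : ℂ) * β i)
    (fun i hi => hβ2 i (Finset.ne_of_mem_erase hi)), ← Finset.mul_sum, htriv0,
    Matrix.trace_one, Fintype.card_fin, hd0] at hsum
  refine ss_not_integral p hp _ (IsIntegral.sum _ (s := Finset.univ.erase i0) fun i _ => hβ1 i)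
    (by rwa [Nat.cast_one, one_mul] at hsum)

universe u

theorem ss_comap_inj {G H : Type*} [Group G] [Group H] (f : G →* H) (hf : Function.Injective f)
    (K : Subgroup H) : Function.Injective (f.subgroupComap K) := by
  intro x y hxy
  have : f x = f y := congrArg Subtype.val hxy
  exact Subtype.ext (hf this)

/-- Recursive form of `σ`-solubility. -/
inductive SSol {ι : Type*} (σ : ι → Set ℕ) : (G : Type u) → [Group G] → Prop
  | primary (G : Type u) [Group G] [Finite G] (i : ι)
      (h : ∀ p : ℕ, p.Prime → p ∣ Nat.card G → p ∈ σ i) : SSol σ G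
  | ext (G : Type u) [Group G] (N : Subgroup G) [N.Normal] (h1 : SSol σ N)
      (h2 : SSol σ (G ⧸ N)) : SSol σ G

theorem SSol.of_injective {ι : Type*} {σ : ι → Set ℕ} {G : Type u} [Group G] (h : SSol σ G) :
    ∀ {H : Type u} [Group H] (f : H →* G), Function.Injective f → SSol σ H := by
  induction h with
  | primary G i h =>
    intro H _ f hf
    have : Finite H := Finite.of_injective f hf
    exact SSol.primary H i fun p hp hd => h p hp (hd.trans (Subgroup.card_dvd_of_injective f hf))
  | ext G N h1 h2 ih1 ih2 =>
    intro H _ f hf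
    refine SSol.ext H (N.comap f) (ih1 (f.subgroupComap N) ?_)
      (ih2 (QuotientGroup.map (N.comap f) N f le_rfl) ?_)
    · intro x y hxy
      exact Subtype.ext (hf (congrArg Subtype.val hxy))
    · rw [← MonoidHom.ker_eq_bot_iff, eq_bot_iff]
      intro x hx
      obtain ⟨x, rfl⟩ := QuotientGroup.mk_surjective x
      rw [MonoidHom.mem_ker, QuotientGroup.map_mk, QuotientGroup.eq_one_iff] at hx
      rw [Subgroup.mem_bot, QuotientGroup.eq_one_iff]
      exact hx

theorem SSol.of_surjective {ι : Type*} {σ : ι → Set ℕ} {G : Type u} [Group G] (h : SSol σ G) :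
    ∀ {H : Type u} [Group H] (f : G →* H), Function.Surjective f → SSol σ H := by
  induction h with
  | primary G i h =>
    intro H _ f hf
    have : Finite H := Finite.of_surjective f hf
    exact SSol.primary H i fun p hp hd => h p hp (hd.trans (Subgroup.card_dvd_of_surjective f hf))
  | ext G N h1 h2 ih1 ih2 =>
    intro H _ f hf
    have hn : (N.map f).Normal := Subgroup.Normal.map inferInstance f hf
    refine SSol.ext H (N.map f) (ih1 (f.subgroupMap N) (f.subgroupMap_surjective N))
      (ih2 (QuotientGroup.map N (N.map f) f (Subgroup.le_comap_map f N)) ?_)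
    intro x
    obtain ⟨x, rfl⟩ := QuotientGroup.mk_surjective x
    obtain ⟨y, rfl⟩ := hf x
    exact ⟨y, rfl⟩

theorem ss_prime_dvd_sup {G : Type*} [Group G] (H K : Subgroup G) [K.Normal]
    (p : ℕ) (hp : p.Prime) (h : p ∣ Nat.card ↥(H ⊔ K)) : p ∣ Nat.card H ∨ p ∣ Nat.card K := by
  rw [← Subgroup.relIndex_bot_left, ← Subgroup.relIndex_mul_relIndex ⊥ K (H ⊔ K) bot_le
    le_sup_right, Subgroup.relIndex_bot_left, Subgroup.relIndex_sup_right, hp.dvd_mul] at h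
  rcases h with h | h
  · exact Or.inr h
  · exact Or.inl (h.trans (Subgroup.relIndex_dvd_card K H))

theorem ss_charify {G : Type*} [Group G] [Finite G] (ρ : Set ℕ) (M : Subgroup G) (hM : M.Normal)
    (hb : M ≠ ⊥) (h : ∀ p : ℕ, p.Prime → p ∣ Nat.card M → p ∈ ρ) :
    ∃ M : Subgroup G, M.Characteristic ∧ M ≠ ⊥ ∧ ∀ p : ℕ, p.Prime → p ∣ Nat.card M → p ∈ ρ := by
  let s : Set (Subgroup G) := {K | K.Normal ∧ ∀ p : ℕ, p.Prime → p ∣ Nat.card K → p ∈ ρ}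
  obtain ⟨M0, hle, hmax⟩ := (Set.toFinite s).exists_le_maximal (a := M) ⟨hM, h⟩
  refine ⟨M0, ?_, ?_, hmax.prop.2⟩
  · rw [Subgroup.characteristic_iff_map_le]
    intro φ
    have hn0 : M0.Normal := hmax.prop.1
    have hn : (M0.map φ.toMonoidHom).Normal := Subgroup.Normal.map hn0 _ φ.surjective
    have hmem : M0 ⊔ M0.map φ.toMonoidHom ∈ s := by
      refine ⟨inferInstance, fun p hp hd => ?_⟩
      rcases ss_prime_dvd_sup _ _ p hp hd with hd | hd
      · exact hmax.prop.2 p hp hd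
      · exact hmax.prop.2 p hp (hd.trans (Subgroup.card_map_dvd _ _))
    exact le_sup_right.trans (hmax.le_of_ge hmem le_sup_left)
  · rintro rfl
    exact hb (le_bot_iff.1 hle)

theorem SSol.exists_primary {ι : Type*} {σ : ι → Set ℕ} {G : Type u} [Group G] (h : SSol σ G) :
    Finite G → Nontrivial G → ∃ i, ∃ M : Subgroup G, M.Normal ∧ M ≠ ⊥ ∧
      ∀ p : ℕ, p.Prime → p ∣ Nat.card M → p ∈ σ i := by
  induction h with
  | primary G i h =>
    intro _ _
    exact ⟨i, ⊤, inferInstance, top_ne_bot, by simpa using h⟩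
  | ext G N h1 h2 ih1 ih2 =>
    intro _ _
    by_cases hN : N = ⊥
    · have hinj : Function.Injective (QuotientGroup.mk' N) := by
        rw [← MonoidHom.ker_eq_bot_iff, QuotientGroup.ker_mk', hN]
      obtain ⟨i, M, hM, hb, hp⟩ := ih2 inferInstance hinj.nontrivial
      refine ⟨i, M.comap (QuotientGroup.mk' N), inferInstance, ?_, ?_⟩
      · intro h
        apply hb
        rw [← Subgroup.map_comap_eq_self_of_surjective (QuotientGroup.mk'_surjective N) M, h,
          Subgroup.map_bot]
      · intro p hpp hd
        refine hp p hpp (hd.trans (Subgroup.card_dvd_of_injective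
          ((QuotientGroup.mk' N).subgroupComap M) ?_))
        intro x y hxy
        exact Subtype.ext (hinj (congrArg Subtype.val hxy))
    · obtain ⟨i, M, hM, hb, hp⟩ := ih1 inferInstance ((Subgroup.nontrivial_iff_ne_bot N).2 hN)
      obtain ⟨M', hc, hb', hp'⟩ := ss_charify (σ i) M hM hb hp
      refine ⟨i, M'.map N.subtype, inferInstance, ?_, ?_⟩
      · intro h
        exact hb' ((Subgroup.map_eq_bot_iff_of_injective _ N.subtype_injective).1 h)
      · intro p hpp hd
        exact hp' p hpp (hd.trans (Subgroup.card_map_dvd _ _))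

theorem SSol.sigmaSoluble {ι : Type*} {σ : ι → Set ℕ} (n : ℕ) : ∀ (G : Type u) [Group G] [Finite G],
    Nat.card G = n → SSol σ G → SigmaSoluble σ G := by
  induction n using Nat.strong_induction_on with
  | _ n ih =>
    intro G _ _ hn h
    rcases subsingleton_or_nontrivial G with hs | hnt
    · exact ⟨0, fun _ => ⊥, rfl, Subsingleton.elim _ _, fun _ _ _ => le_rfl,
        fun _ => inferInstance, fun k => k.elim0⟩
    · obtain ⟨i, M, hM, hb, hp⟩ := h.exists_primary inferInstance hnt
      have hlt : Nat.card (G ⧸ M) < n := by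
        rw [← hn, Subgroup.card_eq_card_quotient_mul_card_subgroup M]
        have h1 : 1 < Nat.card M := (Subgroup.one_lt_card_iff_ne_bot M).2 hb
        have h2 : 0 < Nat.card (G ⧸ M) := Nat.card_pos
        nlinarith
      obtain ⟨m, c, c0, c1, hmono, hnorm, hprim⟩ := ih _ hlt (G ⧸ M) rfl
        (h.of_surjective (QuotientGroup.mk' M) (QuotientGroup.mk'_surjective M))
      refine ⟨m + 1, Fin.cons ⊥ (fun k => (c k).comap (QuotientGroup.mk' M)), rfl, ?_, ?_, ?_, ?_⟩
      · rw [← Fin.succ_last, Fin.cons_succ, c1, Subgroup.comap_top]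
      · rw [Fin.monotone_iff_le_succ]
        intro k
        refine Fin.cases ?_ (fun k => ?_) k
        · exact bot_le
        · rw [← Fin.succ_castSucc, Fin.cons_succ, Fin.cons_succ]
          exact Subgroup.comap_mono (hmono (Fin.castSucc_le_succ k))
      · intro k
        refine Fin.cases ?_ (fun k => ?_) k
        · exact (inferInstance : (⊥ : Subgroup G).Normal)
        · have := hnorm k
          rw [Fin.cons_succ]
          infer_instance
      · intro k
        refine Fin.cases ?_ (fun k => ?_) k
        · refine ⟨i, fun p hpp hd => hp p hpp ?_⟩
          rw [Fin.castSucc_zero, Fin.cons_zero, Fin.cons_succ, c0, MonoidHom.comap_bot,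
            QuotientGroup.ker_mk'] at hd
          change p ∣ (⊥ : Subgroup G).relIndex M at hd
          rwa [Subgroup.relIndex_bot_left] at hd
        · obtain ⟨j, hj⟩ := hprim k
          refine ⟨j, fun p hpp hd => hj p hpp ?_⟩
          rw [← Fin.succ_castSucc, Fin.cons_succ, Fin.cons_succ] at hd
          change p ∣ Subgroup.relIndex _ _ at hd
          rwa [Subgroup.relIndex_comap, Subgroup.map_comap_eq_self_of_surjective
            (QuotientGroup.mk'_surjective M)] at hd

theorem ss_of_sigmaSoluble {ι : Type*} {σ : ι → Set ℕ} (hσ : SigmaPartition σ) (G : Type u)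
    [Group G] [Finite G] (h : SigmaSoluble σ G) : SSol σ G := by
  obtain ⟨m, c, c0, c1, hmono, hnorm, hprim⟩ := h
  obtain ⟨i, hi⟩ : ∃ i, 2 ∈ σ i := by
    have : (2 : ℕ) ∈ ⋃ i, σ i := by rw [hσ.2.2]; exact Nat.prime_two
    simpa using this
  have key : ∀ k, SSol σ (c k) := by
    intro k
    induction k using Fin.induction with
    | zero =>
      refine SSol.primary _ i fun p hp hd => ?_
      rw [c0, Subgroup.card_bot] at hd
      exact absurd (Nat.dvd_one.1 hd) hp.one_lt.ne'
    | succ k ih =>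
      have := hnorm k.castSucc
      refine SSol.ext _ ((c k.castSucc).subgroupOf (c k.succ)) ?_ ?_
      · refine ih.of_injective ((c k.succ).subtype.subgroupComap (c k.castSucc))
          (ss_comap_inj _ (Subgroup.subtype_injective _) _)
      · obtain ⟨j, hj⟩ := hprim k
        exact SSol.primary _ j hj
  have h1 := key (Fin.last m)
  rw [c1] at h1
  exact h1.of_surjective (Subgroup.topEquiv (G := G)).toMonoidHom
    (Subgroup.topEquiv (G := G)).surjective

theorem ss_relIndex_orbit {G : Type*} [Group G] (T V : Subgroup G) :
    T.relIndex V = (MulAction.orbit V ((1 : G) : G ⧸ T)).ncard := by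
  rw [← MulAction.index_stabilizer, Subgroup.relIndex]
  congr 1
  ext x
  rw [MulAction.mem_stabilizer_iff, Subgroup.mem_subgroupOf]
  change _ ↔ (((x : G) * 1 : G) : G ⧸ T) = ((1 : G) : G ⧸ T)
  rw [mul_one, eq_comm, QuotientGroup.eq]
  simp

theorem ss_mul_univ_iff {G : Type*} [Group G] [Finite G] (T V : Subgroup G) :
    T.relIndex V = T.index ↔ ∀ g : G, ∃ v ∈ V, ∃ t ∈ T, v * t = g := by
  rw [ss_relIndex_orbit, Subgroup.index, ← Set.ncard_univ, show
    (MulAction.orbit V ((1 : G) : G ⧸ T)).ncard = (Set.univ : Set (G ⧸ T)).ncard ↔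
      MulAction.orbit V ((1 : G) : G ⧸ T) = Set.univ from
    ⟨fun h => Set.eq_of_subset_of_ncard_le (Set.subset_univ _) h.ge, fun h => by rw [h]⟩,
    Set.eq_univ_iff_forall]
  constructor
  · intro h g
    obtain ⟨v, hv⟩ := h (g : G ⧸ T)
    refine ⟨v, v.2, (v : G)⁻¹ * g, ?_, by group⟩
    change (((v : G) * 1 : G) : G ⧸ T) = _ at hv
    rw [mul_one, QuotientGroup.eq] at hv
    exact hv
  · intro h x
    obtain ⟨g, rfl⟩ := QuotientGroup.mk_surjective x
    obtain ⟨v, hv, t, ht, rfl⟩ := h g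
    refine ⟨⟨v, hv⟩, ?_⟩
    change ((v * 1 : G) : G ⧸ T) = _
    rw [QuotientGroup.eq]
    simpa using ht

theorem ss_relIndex_dvd {G : Type*} [Group G] [Finite G] (T N : Subgroup G) [N.Normal] :
    T.relIndex N ∣ T.index := by
  have h0 : T.relIndex N = T.relIndex (T ⊔ N) := by
    have e1 : T.relIndex N * Nat.card ↥(T ⊓ N) = Nat.card N := by
      rw [← Subgroup.inf_relIndex_right, mul_comm, ← Subgroup.relIndex_bot_left,
        Subgroup.relIndex_mul_relIndex _ _ _ bot_le inf_le_right, Subgroup.relIndex_bot_left]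
    have e2 : N.relIndex T * Nat.card ↥(T ⊓ N) = Nat.card T := by
      rw [← Subgroup.inf_relIndex_left, mul_comm, ← Subgroup.relIndex_bot_left,
        Subgroup.relIndex_mul_relIndex _ _ _ bot_le inf_le_left, Subgroup.relIndex_bot_left]
    have e3 : Nat.card N * N.relIndex T = Nat.card ↥(T ⊔ N) := by
      rw [← Subgroup.relIndex_sup_right, ← Subgroup.relIndex_bot_left,
        Subgroup.relIndex_mul_relIndex _ _ _ bot_le le_sup_right, Subgroup.relIndex_bot_left]
    have e4 : Nat.card T * T.relIndex (T ⊔ N) = Nat.card ↥(T ⊔ N) := by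
      rw [← Subgroup.relIndex_bot_left,
        Subgroup.relIndex_mul_relIndex _ _ _ bot_le le_sup_left, Subgroup.relIndex_bot_left]
    have hT : 0 < Nat.card T := Nat.card_pos
    apply Nat.eq_of_mul_eq_mul_left hT
    rw [e4, ← e3, ← e1, ← e2]
    ring
  rw [h0]
  exact Subgroup.relIndex_dvd_index_of_le le_sup_left

theorem ss_relIndex_coprime {G : Type*} [Group G] [Finite G] (A B : Subgroup G)
    (h : Nat.Coprime A.index B.index) : A.relIndex B = A.index := by
  have h1 : A.relIndex B * B.index = (A ⊓ B).index := by
    rw [← Subgroup.inf_relIndex_right]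
    exact Subgroup.relIndex_mul_index inf_le_right
  have h2 : A.index * B.index ∣ (A ⊓ B).index := h.mul_dvd_of_dvd_of_dvd
    (Subgroup.index_dvd_of_le inf_le_left) (Subgroup.index_dvd_of_le inf_le_right)
  have h3 := Subgroup.index_inf_le (H := A) (K := B)
  have h4 : A.index * B.index = (A ⊓ B).index :=
    le_antisymm (Nat.le_of_dvd (Nat.pos_of_ne_zero Subgroup.index_ne_zero_of_finite) h2) h3
  rw [← h4] at h1
  exact Nat.eq_of_mul_eq_mul_right (Nat.pos_of_ne_zero Subgroup.index_ne_zero_of_finite) h1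

theorem ss_claimA {G : Type*} [Group G] [Finite G] [IsSimpleGroup G] (A B : Subgroup G)
    (p q : ℕ) (hp : p.Prime) (hq : q.Prime) (hpq : p ≠ q) (a b : ℕ) (hA : A.index = p ^ a)
    (hB : B.index = q ^ b) (hBt : B ≠ ⊤) (L : Subgroup A) (hL : L.Normal) (hLb : L ≠ ⊥) :
    q ∣ Nat.card L := by
  by_contra hq'
  have hco : Nat.Coprime B.index A.index := by
    rw [hA, hB]
    exact Nat.Coprime.pow _ _ ((Nat.coprime_primes hq hp).2 hpq.symm)
  have h1 : (B.subgroupOf A).index = q ^ b := by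
    rw [← hB]; exact ss_relIndex_coprime B A hco
  have h2 : (B.subgroupOf A).relIndex L = 1 := by
    apply Nat.eq_one_of_dvd_coprimes (a := q ^ b) (b := Nat.card L)
    · exact Nat.Coprime.pow_left _ ((Nat.Prime.coprime_iff_not_dvd hq).2 hq')
    · rw [← h1]; exact ss_relIndex_dvd _ _
    · exact Subgroup.relIndex_dvd_card _ _
  rw [Subgroup.relIndex_eq_one] at h2
  have h3 := (ss_mul_univ_iff A B).1 (ss_relIndex_coprime A B hco.symm)
  have h4 : Subgroup.normalClosure ((L.map A.subtype : Subgroup G) : Set G) ≤ B := by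
    rw [Subgroup.normalClosure, Subgroup.closure_le]
    intro x hx
    rw [Group.mem_conjugatesOfSet_iff] at hx
    obtain ⟨y, hy, hc⟩ := hx
    obtain ⟨g, rfl⟩ := isConj_iff.1 hc
    obtain ⟨s, hs, t, ht, rfl⟩ := h3 g
    obtain ⟨y, hy, rfl⟩ := hy
    have h5 := h2 (hL.conj_mem y hy ⟨t, ht⟩)
    rw [Subgroup.mem_subgroupOf] at h5
    have h6 := B.mul_mem (B.mul_mem hs h5) (B.inv_mem hs)
    have e : s * t * (A.subtype y) * (s * t)⁻¹ =
      s * ((⟨t, ht⟩ * y * ⟨t, ht⟩⁻¹ : A) : G) * s⁻¹ := by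
      simp [mul_assoc]
    rw [e]
    exact h6
  rcases (inferInstance : (Subgroup.normalClosure
    ((L.map A.subtype : Subgroup G) : Set G)).Normal).eq_bot_or_eq_top with h | h
  · have h7 : L.map A.subtype ≤ ⊥ := by rw [← h]; exact Subgroup.le_normalClosure
    exact hLb ((Subgroup.map_eq_bot_iff_of_injective _ A.subtype_injective).1 (le_bot_iff.1 h7))
  · rw [h] at h4
    exact hBt (top_le_iff.1 h4)

theorem ss_card_conj {G : Type*} [Group G] [Finite G] (g : G) :
    Nat.card (conjugatesOf g) = (Subgroup.centralizer {g}).index := by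
  have h1 := MulAction.index_stabilizer (ConjAct G) g
  rw [ConjAct.stabilizer_eq_centralizer] at h1
  rw [Nat.card_coe_set_eq]
  have h2 : MulAction.orbit (ConjAct G) g = conjugatesOf g := by
    ext x
    rw [ConjAct.mem_orbit_conjAct]
    exact isConj_comm
  rw [← h2, ← h1]
  rfl

/-- Burnside's two-prime theorem, for simple groups. -/
theorem ss_burnside {G : Type*} [Group G] [Finite G] [IsSimpleGroup G] (p q : ℕ) (hp : p.Prime)
    (hq : q.Prime) (hqd : q ∣ Nat.card G) (h : ∀ r : ℕ, r.Prime → r ∣ Nat.card G → r = p ∨ r = q) :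
    Subgroup.center G = ⊤ := by
  rcases (inferInstance : (Subgroup.center G).Normal).eq_bot_or_eq_top with hc | hc
  · exfalso
    have : Fact q.Prime := ⟨hq⟩
    let Q : Sylow q G := default
    have hQn : Nontrivial Q := by
      apply (Subgroup.nontrivial_iff_ne_bot _).2
      exact Sylow.ne_bot_of_dvd_card Q hqd
    have hZ := Q.isPGroup'.center_nontrivial
    obtain ⟨z, hz⟩ := exists_ne (1 : Subgroup.center Q)
    let g : G := ((z : Q) : G)
    have hg : g ≠ 1 := by
      intro h
      exact hz (Subtype.ext (Subtype.ext h))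
    have hle : (Q : Subgroup G) ≤ Subgroup.centralizer {g} := by
      intro x hx
      rw [Subgroup.mem_centralizer_singleton_iff]
      have := Subgroup.mem_center_iff.1 z.2 ⟨x, hx⟩
      exact congrArg Subtype.val this
    have hnd : ¬ q ∣ (Subgroup.centralizer {g}).index := fun hd =>
      Q.not_dvd_index (hd.trans (Subgroup.index_dvd_of_le hle))
    have hpow := Nat.eq_prime_pow_of_unique_prime_dvd (p := p)
      (n := (Subgroup.centralizer {g}).index) Subgroup.index_ne_zero_of_finite (by
        intro r hr hrd
        rcases h r hr (hrd.trans (Subgroup.index_dvd_card _)) with h | h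
        · exact h
        · exact absurd (h ▸ hrd) hnd)
    exact ss_burnside_class hc g hg p hp _ ((ss_card_conj g).trans hpow)
  · exact hc

theorem ss_main {ι : Type*} {σ : ι → Set ℕ} (hσ : SigmaPartition σ) (n : ℕ) :
    ∀ (G : Type u) [Group G] [Finite G], Nat.card G = n →
      (∀ p : ℕ, p.Prime → p ∣ Nat.card G → ∃ T : Subgroup G, SSol σ T ∧ ∃ k, T.index = p ^ k) →
      SSol σ G := by
  induction n using Nat.strong_induction_on with
  | _ n ih =>
    intro G _ _ hn h
    have hmem : ∀ p : ℕ, p.Prime → ∃ i, p ∈ σ i := by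
      intro p hp
      have : p ∈ ⋃ i, σ i := by rw [hσ.2.2]; exact hp
      simpa using this
    have huniq : ∀ p i j, p ∈ σ i → p ∈ σ j → i = j := by
      intro p i j hi hj
      by_contra hne
      exact Set.disjoint_left.1 (hσ.2.1 hne) hi hj
    by_cases hN : ∃ N : Subgroup G, N.Normal ∧ N ≠ ⊥ ∧ N ≠ ⊤
    · obtain ⟨N, hNn, hb, ht⟩ := hN
      have hcard := Subgroup.card_eq_card_quotient_mul_card_subgroup N
      have h1 : 1 < Nat.card N := (Subgroup.one_lt_card_iff_ne_bot N).2 hb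
      have h2 : 0 < Nat.card (G ⧸ N) := Nat.card_pos
      refine SSol.ext G N (ih _ ?_ N rfl ?_) (ih _ ?_ (G ⧸ N) rfl ?_)
      · rw [← hn]
        exact lt_of_le_of_ne (Subgroup.card_le_card_group N)
          (fun h => ht (Subgroup.eq_top_of_card_eq N h))
      · intro p hp hd
        obtain ⟨T, hT, k, hk⟩ := h p hp (hd.trans (Subgroup.card_subgroup_dvd_card N))
        refine ⟨T.subgroupOf N, hT.of_injective (N.subtype.subgroupComap T)
          (ss_comap_inj _ (Subgroup.subtype_injective _) _), ?_⟩
        · have h3 := ss_relIndex_dvd T N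
          rw [hk, Nat.dvd_prime_pow hp] at h3
          obtain ⟨m, -, hm⟩ := h3
          exact ⟨m, hm⟩
      · rw [← hn]; nlinarith
      · intro p hp hd
        obtain ⟨T, hT, k, hk⟩ := h p hp (hd.trans (Subgroup.card_quotient_dvd_card N))
        refine ⟨T.map (QuotientGroup.mk' N), hT.of_surjective
          ((QuotientGroup.mk' N).subgroupMap T) (MonoidHom.subgroupMap_surjective _ _), ?_⟩
        have h3 := Subgroup.index_map_dvd T (QuotientGroup.mk'_surjective N)
        rw [hk, Nat.dvd_prime_pow hp] at h3
        obtain ⟨m, -, hm⟩ := h3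
        exact ⟨m, hm⟩
    by_contra hcon
    have hprim : ∀ i, ∃ p : ℕ, p.Prime ∧ p ∣ Nat.card G ∧ p ∉ σ i := by
      intro i
      by_contra hc
      push Not at hc
      exact hcon (SSol.primary G i hc)
    have hone : ∀ p : ℕ, p.Prime → ∃ q : ℕ, q.Prime ∧ q ∣ Nat.card G ∧ q ≠ p := by
      intro p hp
      obtain ⟨i, hi⟩ := hmem p hp
      obtain ⟨q, hq, hqd, hqi⟩ := hprim i
      exact ⟨q, hq, hqd, fun h => hqi (h ▸ hi)⟩
    have hnt : Nontrivial G := by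
      obtain ⟨q, hq, hqd, -⟩ := hone 2 Nat.prime_two
      rw [← Finite.one_lt_card_iff_nontrivial]
      exact lt_of_lt_of_le hq.one_lt (Nat.le_of_dvd Nat.card_pos hqd)
    have hsimple : IsSimpleGroup G := ⟨fun H hH => by
      by_contra hc
      push Not at hc
      exact hN ⟨H, hH, hc.1, hc.2⟩⟩
    -- the main claim
    have hclaim : ∀ p : ℕ, p.Prime → p ∣ Nat.card G → ∃ j, ∀ q : ℕ, q.Prime → q ∣ Nat.card G →
        q ≠ p → q ∈ σ j := by
      intro p hp hpd
      obtain ⟨A, hA, a, ha⟩ := h p hp hpd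
      have hAb : A ≠ ⊥ := by
        rintro rfl
        obtain ⟨q, hq, hqd, hqp⟩ := hone p hp
        rw [Subgroup.index_bot] at ha
        rw [ha] at hqd
        exact hqp ((Nat.prime_dvd_prime_iff_eq hq hp).1 (hq.dvd_of_dvd_pow hqd))
      obtain ⟨j, L, hL, hLb, hLp⟩ := hA.exists_primary inferInstance
        ((Subgroup.nontrivial_iff_ne_bot A).2 hAb)
      refine ⟨j, fun q hq hqd hqp => hLp q hq ?_⟩
      obtain ⟨B, hB, b, hb⟩ := h q hq hqd
      refine ss_claimA A B p q hp hq hqp.symm a b ha hb ?_ L hL hLb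
      rintro rfl
      exact hcon (hB.of_surjective (Subgroup.topEquiv (G := G)).toMonoidHom
        (Subgroup.topEquiv (G := G)).surjective)
    obtain ⟨i1, -⟩ := hmem 2 Nat.prime_two
    obtain ⟨p1, hp1, hp1d, -⟩ := hprim i1
    obtain ⟨j0, hj0⟩ := hclaim p1 hp1 hp1d
    obtain ⟨q, hq, hqd, hqp⟩ := hone p1 hp1
    obtain ⟨j1, hj1⟩ := hclaim q hq hqd
    have hp1j0 : p1 ∉ σ j0 := by
      intro hc
      obtain ⟨r, hr, hrd, hrj⟩ := hprim j0
      by_cases hrp : r = p1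
      · exact hrj (hrp ▸ hc)
      · exact hrj (hj0 r hr hrd hrp)
    have htwo : ∀ r : ℕ, r.Prime → r ∣ Nat.card G → r = p1 ∨ r = q := by
      intro r hr hrd
      by_contra hc
      push Not at hc
      have h1 := hj0 r hr hrd hc.1
      have h2 := hj1 r hr hrd hc.2
      have h3 := hj1 p1 hp1 hp1d hqp.symm
      rw [huniq r j1 j0 h2 h1] at h3
      exact hp1j0 h3
    have hcen := ss_burnside p1 q hp1 hq hqd htwo
    -- a Sylow subgroup is then normal
    have : Fact q.Prime := ⟨hq⟩
    let Q : Sylow q G := default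
    have hQn : (Q : Subgroup G).Normal := ⟨fun x hx g => by
      have : x ∈ Subgroup.center G := by rw [hcen]; trivial
      rw [Subgroup.mem_center_iff.1 this g]
      simpa using hx⟩
    rcases hQn.eq_bot_or_eq_top with hb | ht
    · exact Sylow.ne_bot_of_dvd_card Q hqd hb
    · obtain ⟨k, hk⟩ := Q.isPGroup'.exists_card_eq
      have hk' : Nat.card (Q : Subgroup G) = q ^ k := hk
      rw [ht, Subgroup.card_top] at hk'
      rw [hk'] at hp1d
      exact hqp ((Nat.prime_dvd_prime_iff_eq hp1 hq).1 (hp1.dvd_of_dvd_pow hp1d)).symm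

/-- A finite group `G` is `σ`-soluble if and only if every maximal subgroup of every
Sylow subgroup of `G` has a `σ`-soluble supplement in `G`. -/
theorem sigma_soluble_iff_supplements {ι : Type*} (σ : ι → Set ℕ)
    (hσ : SigmaPartition σ) (G : Type*) [Group G] [Finite G] :
    SigmaSoluble σ G ↔
      ∀ p : ℕ, p.Prime → p ∣ Nat.card G →
        ∀ (P : Sylow p G) (V : Subgroup G), V < ↑P →
          (∀ W : Subgroup G, V < W → W ≤ ↑P → W = ↑P) →
          ∃ T : Subgroup G, (V : Set G) * (T : Set G) = Set.univ ∧ SigmaSoluble σ ↥T := by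
  constructor
  · intro h p _ _ P V _ _
    refine ⟨⊤, ?_, ?_⟩
    · rw [Set.eq_univ_iff_forall]
      intro x
      exact ⟨1, V.one_mem, x, trivial, one_mul x⟩
    · exact SSol.sigmaSoluble _ _ rfl ((ss_of_sigmaSoluble hσ G h).of_injective
        (Subgroup.subtype ⊤) (Subgroup.subtype_injective ⊤))
  · intro h
    refine SSol.sigmaSoluble _ G rfl (ss_main hσ _ G rfl ?_)
    intro p hp hpd
    have : Fact p.Prime := ⟨hp⟩
    let P : Sylow p G := default
    have hPb : (P : Subgroup G) ≠ ⊥ := Sylow.ne_bot_of_dvd_card P hpd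
    obtain ⟨V, -, hV⟩ := (Set.toFinite {V : Subgroup G | V < ↑P}).exists_le_maximal
      (a := ⊥) (bot_lt_iff_ne_bot.2 hPb)
    have hVP : V < ↑P := hV.prop
    obtain ⟨T, hT, hTs⟩ := h p hp hpd P V hVP (by
      intro W hW hWP
      by_contra hne
      exact hW.not_ge (hV.le_of_ge (lt_of_le_of_ne hWP hne) hW.le))
    refine ⟨T, ss_of_sigmaSoluble hσ T hTs, ?_⟩
    have h1 : T.relIndex V = T.index := (ss_mul_univ_iff T V).2 (by
      intro g
      have : g ∈ (V : Set G) * (T : Set G) := by rw [hT]; trivial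
      obtain ⟨v, hv, t, ht, e⟩ := this
      exact ⟨v, hv, t, ht, e⟩)
    have h2 : T.index ∣ Nat.card (P : Subgroup G) := by
      rw [← h1]
      exact (Subgroup.relIndex_dvd_card T V).trans (Subgroup.card_dvd_of_le hVP.le)
    obtain ⟨k, hk⟩ := P.isPGroup'.exists_card_eq
    have hk' : Nat.card (P : Subgroup G) = p ^ k := hk
    rw [hk', Nat.dvd_prime_pow hp] at h2
    obtain ⟨m, -, hm⟩ := h2
    exact ⟨m, hm⟩
end

section
/- Let G be a finite group and σ a partition of the set of all primes. Then G is σ-nilpotent if and only if for every prime p dividing |G|, every Sylow p-subgroup P of G, and every maximal subgroup V of P, there exists a σ-nilpotent subgroup T of G with VT = G. -/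
open scoped Pointwise

namespace SigmaAux

variable {G : Type*} [Group G]

lemma relIndex_eq_ncard_orbit (H K : Subgroup G) :
    H.relIndex K = (MulAction.orbit K ((1 : G) : G ⧸ H)).ncard := by
  rw [← MulAction.index_stabilizer, Subgroup.relIndex]
  congr 1
  ext x
  rw [MulAction.mem_stabilizer_iff, Subgroup.mem_subgroupOf]
  change _ ↔ (((x : G) * 1 : G) : G ⧸ H) = ((1 : G) : G ⧸ H)
  rw [mul_one, eq_comm, QuotientGroup.eq]
  simp

lemma exists_mul_of_relIndex [Finite G] {H K : Subgroup G} (h : H.relIndex K = H.index) (g : G) :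
    ∃ k ∈ K, ∃ x ∈ H, g = k * x := by
  rw [relIndex_eq_ncard_orbit, Subgroup.index, ← Set.ncard_univ] at h
  have h2 := Set.eq_of_subset_of_ncard_le (Set.subset_univ _) h.ge
  have : ((g : G) : G ⧸ H) ∈ MulAction.orbit K ((1 : G) : G ⧸ H) := by rw [h2]; trivial
  obtain ⟨k, hk⟩ := this
  change (((k : G) * 1 : G) : G ⧸ H) = (g : G ⧸ H) at hk
  rw [mul_one, QuotientGroup.eq] at hk
  exact ⟨k, k.2, _, hk, by group⟩

lemma index_dvd_of_mul [Finite G] {H K : Subgroup G}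
    (h : ∀ g : G, ∃ k ∈ K, ∃ x ∈ H, g = k * x) : H.index ∣ Nat.card K := by
  have : H.relIndex K = H.index := by
    rw [relIndex_eq_ncard_orbit, Subgroup.index, ← Set.ncard_univ]
    congr 1
    rw [Set.eq_univ_iff_forall]
    intro q
    induction q using QuotientGroup.induction_on with
    | H g =>
      obtain ⟨k, hk, x, hx, rfl⟩ := h g
      refine ⟨⟨k, hk⟩, ?_⟩
      change ((k * 1 : G) : G ⧸ H) = _
      rw [mul_one, QuotientGroup.eq]
      simpa using hx
  rw [← this]
  exact Subgroup.index_dvd_card _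

lemma exists_mul_of_coprime_index [Finite G] {H K : Subgroup G}
    (h : H.index.Coprime K.index) (g : G) : ∃ k ∈ K, ∃ x ∈ H, g = k * x := by
  apply exists_mul_of_relIndex
  have h1 : H.relIndex K * K.index = (H ⊓ K).index := by
    rw [← Subgroup.inf_relIndex_right]
    exact Subgroup.relIndex_mul_index inf_le_right
  have h2 : H.index ∣ H.relIndex K * K.index := by
    rw [h1]; exact Subgroup.index_dvd_of_le inf_le_left
  have h3 := h.dvd_of_dvd_mul_right h2
  refine le_antisymm ?_ (Nat.le_of_dvd (Nat.pos_of_ne_zero ?_) h3)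
  · rw [relIndex_eq_ncard_orbit, Subgroup.index, ← Set.ncard_univ]
    exact Set.ncard_le_ncard (Set.subset_univ _)
  · exact Subgroup.index_ne_zero_of_finite

/-- If `q` does not divide the index of `T`, then `T` contains a Sylow `q`-subgroup. -/
lemma exists_sylow_le [Finite G] {q : ℕ} (hq : q.Prime) (T : Subgroup G) (h : ¬ q ∣ T.index) :
    ∃ S : Sylow q G, (S : Subgroup G) ≤ T := by
  have := Fact.mk hq
  obtain ⟨S⟩ : Nonempty (Sylow q T) := inferInstance
  have hp : IsPGroup q ((S : Subgroup T).map T.subtype) := S.2.map _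
  have hi : ¬ q ∣ ((S : Subgroup T).map T.subtype).index := by
    rw [Subgroup.index_map_subtype]
    exact hq.not_dvd_mul S.not_dvd_index h
  exact ⟨hp.toSylow hi, Subgroup.map_subtype_le _⟩

lemma mem_of_coprime [Finite G] (N : Subgroup G) [N.Normal] {x : G}
    (h : (orderOf x).Coprime N.index) : x ∈ N := by
  rw [← QuotientGroup.eq_one_iff, ← orderOf_eq_one_iff]
  refine Nat.eq_one_of_dvd_coprimes h ?_ ?_
  · exact orderOf_map_dvd (QuotientGroup.mk' N) x
  · exact orderOf_dvd_natCard _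

lemma card_sup_primes [Finite G] (ρ : Set ℕ) {H K : Subgroup G} [K.Normal]
    (hH : ∀ p : ℕ, p.Prime → p ∣ Nat.card H → p ∈ ρ)
    (hK : ∀ p : ℕ, p.Prime → p ∣ Nat.card K → p ∈ ρ) :
    ∀ p : ℕ, p.Prime → p ∣ Nat.card (H ⊔ K : Subgroup G) → p ∈ ρ := by
  intro p hp h
  rw [← Subgroup.relIndex_bot_left, ← Subgroup.relIndex_mul_relIndex ⊥ K (H ⊔ K) bot_le le_sup_right,
    Subgroup.relIndex_bot_left, Subgroup.relIndex_sup_right] at h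
  rcases hp.dvd_mul.1 h with h | h
  · exact hK p hp h
  · exact hH p hp (h.trans (Subgroup.relIndex_dvd_card _ _))

lemma card_biSup_primes [Finite G] (ρ : Set ℕ) {κ : Type*} (s : Finset κ) (H : κ → Subgroup G)
    (hn : ∀ k, (H k).Normal)
    (hH : ∀ k ∈ s, ∀ p : ℕ, p.Prime → p ∣ Nat.card (H k) → p ∈ ρ) :
    (s.sup H).Normal ∧ ∀ p : ℕ, p.Prime → p ∣ Nat.card (s.sup H : Subgroup G) → p ∈ ρ := by
  classical
  induction s using Finset.induction_on with
  | empty =>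
    refine ⟨by rw [Finset.sup_empty]; infer_instance, fun p hp h => ?_⟩
    rw [Finset.sup_empty, Subgroup.card_bot] at h
    exact absurd (Nat.dvd_one.1 h) hp.ne_one
  | insert a s ha ih =>
    obtain ⟨i1, i2⟩ := ih fun k hk => hH k (Finset.mem_insert_of_mem hk)
    rw [Finset.sup_insert]
    have := hn a
    have := i1
    exact ⟨inferInstance, card_sup_primes ρ (hH a (Finset.mem_insert_self _ _)) i2⟩

/-- A finite `σ`-nilpotent group splits as a `σ j`-group times a `(σ j)'`-group. -/
lemma split [Finite G] {ι : Type*} {σ : ι → Set ℕ} (hσ : SigmaPartition σ)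
    (h : SigmaNilpotent σ G) (j : ι) : ∃ A B : Subgroup G, A.Normal ∧ B.Normal ∧
      Disjoint A B ∧ A.index = Nat.card B ∧ B.index = Nat.card A ∧
      (∀ p : ℕ, p.Prime → p ∣ Nat.card A → p ∈ σ j) ∧
      (∀ p : ℕ, p.Prime → p ∣ Nat.card B → p ∈ (σ j)ᶜ) := by
  classical
  obtain ⟨n, H, hn, -, htop, hc⟩ := h
  choose c hc using hc
  obtain ⟨a1, a2⟩ := card_biSup_primes (σ j) (Finset.univ.filter fun k => c k = j) H hn
    (by intro k hk p hp hd; rw [← (Finset.mem_filter.1 hk).2]; exact hc k p hp hd)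
  obtain ⟨b1, b2⟩ := card_biSup_primes (σ j)ᶜ (Finset.univ.filter fun k => ¬ c k = j) H hn
    (by
      intro k hk p hp hd
      exact Set.disjoint_left.1 (hσ.2.1 (Finset.mem_filter.1 hk).2) (hc k p hp hd))
  set A := (Finset.univ.filter fun k => c k = j).sup H
  set B := (Finset.univ.filter fun k => ¬ c k = j).sup H
  have hd : Disjoint A B := by
    apply Subgroup.disjoint_of_coprime_natCard
    apply Nat.coprime_of_dvd
    intro p hp h1 h2
    exact b2 p hp h2 (a2 p hp h1)
  have ht : A ⊔ B = ⊤ := by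
    rw [eq_top_iff, ← htop, iSup_le_iff]
    intro k
    by_cases hk : c k = j
    · exact le_trans (Finset.le_sup (f := H) (by simp [hk])) le_sup_left
    · exact le_trans (Finset.le_sup (f := H) (by simp [hk])) le_sup_right
  have hcomp : Subgroup.IsComplement' A B := by
    apply Subgroup.isComplement'_of_disjoint_and_mul_eq_univ hd
    rw [← Subgroup.mul_normal, ht]; rfl
  exact ⟨A, B, a1, b1, hd, hcomp.symm.index_eq_card, hcomp.index_eq_card, a2, b2⟩

/-- Elements of prime power order for primes in different classes commute. -/
lemma commute_of_sigmaNilpotent [Finite G] {ι : Type*} {σ : ι → Set ℕ} (hσ : SigmaPartition σ)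
    (h : SigmaNilpotent σ G) {j : ι} {p q : ℕ} (hp : p.Prime) (hq : q.Prime) (hpj : p ∈ σ j)
    (hqj : q ∉ σ j) {x y : G} {a b : ℕ} (hx : orderOf x = p ^ a) (hy : orderOf y = q ^ b) :
    Commute x y := by
  obtain ⟨A, B, a1, b1, hd, iA, iB, cA, cB⟩ := split hσ h j
  refine Subgroup.commute_of_normal_of_disjoint A B a1 b1 hd x y ?_ ?_
  · apply mem_of_coprime
    rw [hx, iA]
    apply Nat.Coprime.pow_left
    rw [hp.coprime_iff_not_dvd]
    exact fun hh => cB p hp hh hpj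
  · apply mem_of_coprime
    rw [hy, iB]
    apply Nat.Coprime.pow_left
    rw [hq.coprime_iff_not_dvd]
    exact fun hh => hqj (cA q hq hh)

/-- The hypothesis on supplements. -/
def Supp {ι : Type*} (σ : ι → Set ℕ) (G : Type*) [Group G] : Prop :=
  ∀ p : ℕ, p.Prime → p ∣ Nat.card G →
        ∀ (P : Sylow p G) (V : Subgroup G), V < ↑P →
          (∀ W : Subgroup G, V < W → W ≤ ↑P → W = ↑P) →
          ∃ T : Subgroup G, (V : Set G) * (T : Set G) = Set.univ ∧
            SigmaNilpotent σ ↥T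

lemma exists_T [Finite G] {ι : Type*} {σ : ι → Set ℕ} (h : Supp σ G) {p : ℕ} (hp : p.Prime)
    (hpG : p ∣ Nat.card G) (P : Sylow p G) (D : Subgroup G) (hD : D < ↑P) :
    ∃ V T : Subgroup G, D ≤ V ∧ V < ↑P ∧ (∀ g : G, ∃ v ∈ V, ∃ t ∈ T, g = v * t) ∧
      SigmaNilpotent σ T ∧ ∀ q : ℕ, q.Prime → q ∣ T.index → q = p := by
  have := Fact.mk hp
  obtain ⟨V, hDV, hV⟩ := exists_le_covBy_of_lt hD
  obtain ⟨T, hT, hN⟩ := h p hp hpG P V hV.lt (fun W h1 h2 =>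
    (h2.eq_or_lt).resolve_right (fun h3 => hV.2 h1 h3))
  have hm : ∀ g : G, ∃ v ∈ V, ∃ t ∈ T, g = v * t := by
    intro g
    have : g ∈ (V : Set G) * (T : Set G) := by rw [hT]; trivial
    obtain ⟨v, hv, t, ht, e⟩ := this
    exact ⟨v, hv, t, ht, e.symm⟩
  refine ⟨V, T, hDV, hV.lt, hm, hN, fun q hq hd => ?_⟩
  have h1 : q ∣ Nat.card V := hd.trans (index_dvd_of_mul hm)
  have h2 : q ∣ Nat.card (P : Subgroup G) := h1.trans (Subgroup.card_dvd_of_le hV.le)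
  obtain ⟨n, hn⟩ := IsPGroup.iff_card.1 P.2
  rw [hn] at h2
  exact (Nat.prime_dvd_prime_iff_eq hq hp).1 (hq.dvd_of_dvd_pow h2)

lemma exists_T' [Finite G] {ι : Type*} {σ : ι → Set ℕ} (h : Supp σ G) {p : ℕ} (hp : p.Prime)
    (hpG : p ∣ Nat.card G) :
    ∃ T : Subgroup G, SigmaNilpotent σ T ∧ ∀ q : ℕ, q.Prime → q ∣ T.index → q = p := by
  have := Fact.mk hp
  obtain ⟨P⟩ : Nonempty (Sylow p G) := inferInstance
  obtain ⟨V, T, -, -, -, h1, h2⟩ := exists_T h hp hpG P ⊥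
    (bot_lt_iff_ne_bot.2 (P.ne_bot_of_dvd_card hpG))
  exact ⟨T, h1, h2⟩

/-- The two-prime case: the Sylow `r`-subgroups are normal. -/
lemma two_primes [Finite G] {ι : Type*} {σ : ι → Set ℕ} (hσ : SigmaPartition σ)
    (h : Supp σ G) {j : ι} {p r : ℕ} (hp : p.Prime) (hr : r.Prime) (hpG : p ∣ Nat.card G)
    (hrj : r ∈ σ j) (hpj : p ∉ σ j)
    (hall : ∀ q : ℕ, q.Prime → q ∣ Nat.card G → q = p ∨ q = r) (R : Sylow r G) :
    (R : Subgroup G).Normal := by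
  have := Fact.mk hp
  have := Fact.mk hr
  set N : Subgroup G := Subgroup.normalizer (R : Set G) with hN
  by_contra hR
  obtain ⟨D0⟩ : Nonempty (Sylow p N) := inferInstance
  obtain ⟨P, hDP⟩ := (D0.2.map N.subtype).exists_le_sylow
  set D := (D0 : Subgroup N).map N.subtype with hD
  have hPN : ∀ W : Subgroup G, IsPGroup p W → W ≤ N → D ≤ W → W = D := by
    intro W hW hWN hDW
    have := D0.3 (Q := W.subgroupOf N) (hW.comap_of_injective _ N.subtype_injective) (by
      rw [Subgroup.subgroupOf, ← Subgroup.map_le_iff_le_comap]; exact hDW)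
    change W = (D0 : Subgroup N).map N.subtype
    have e : W.subgroupOf N = (D0 : Subgroup N) := this
    rw [← e, Subgroup.subgroupOf_map_subtype, inf_eq_left.2 hWN]
  have hlt : D < ↑P := by
    refine lt_of_le_of_ne hDP fun he => hR ?_
    have hNi : N.index = 1 := by
      by_contra h1
      obtain ⟨q, hq, hqd⟩ := Nat.exists_prime_and_dvd h1
      rcases hall q hq (hqd.trans (Subgroup.index_dvd_card _)) with rfl | rfl
      · exact P.not_dvd_index (hqd.trans (Subgroup.index_dvd_of_le
          (he ▸ Subgroup.map_subtype_le _)))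
      · exact R.not_dvd_index (hqd.trans (Subgroup.index_dvd_of_le Subgroup.le_normalizer))
    rw [Subgroup.index_eq_one] at hNi
    exact Subgroup.normalizer_eq_top_iff.1 hNi
  obtain ⟨V, T, hDV, hVP, hm, hT, hTi⟩ := exists_T h hp hpG P D hlt
  -- the normal Sylow `r`-subgroup of `T`
  obtain ⟨A, B, a1, b1, hd, iA, iB, cA, cB⟩ := split hσ hT j
  have hAp : IsPGroup r (A.map T.subtype) := by
    apply IsPGroup.map
    rw [IsPGroup.iff_card]
    refine ⟨_, Nat.eq_prime_pow_of_unique_prime_dvd Nat.card_pos.ne' ?_⟩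
    intro q hq hqd
    rcases hall q hq (hqd.trans ((Subgroup.card_subgroup_dvd_card A).trans
      (Subgroup.card_subgroup_dvd_card T))) with rfl | rfl
    · exact absurd (cA _ hq hqd) hpj
    · rfl
  have hAi : ¬ r ∣ (A.map T.subtype).index := by
    rw [Subgroup.index_map_subtype]
    refine hr.not_dvd_mul ?_ ?_
    · rw [iA]; exact fun hh => cB r hr hh hrj
    · intro hh
      exact hpj (hTi r hr hh ▸ hrj)
  obtain ⟨x, hx⟩ := MulAction.exists_smul_eq G (hAp.toSylow hAi) R
  have hTN : ∀ t ∈ T, x * t * x⁻¹ ∈ N := by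
    intro t ht
    have h1 : ∀ g : G, g ∈ R ↔ x⁻¹ * g * x ∈ A.map T.subtype := by
      intro g
      rw [← hx]
      change g ∈ (x • hAp.toSylow hAi : Sylow r G).toSubgroup ↔ _
      rw [Sylow.coe_subgroup_smul, Subgroup.mem_pointwise_smul_iff_inv_smul_mem]
      change (MulAut.conj x)⁻¹ g ∈ _ ↔ _
      rw [MulAut.conj_inv_apply]
      rfl
    have h2 : ∀ g : G, g ∈ A.map T.subtype ↔ t * g * t⁻¹ ∈ A.map T.subtype := by
      have h3 : ∀ s ∈ T, ∀ g ∈ A.map T.subtype, s * g * s⁻¹ ∈ A.map T.subtype := by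
        rintro s hs _ ⟨a, ha, rfl⟩
        exact ⟨⟨s, hs⟩ * a * ⟨s, hs⟩⁻¹, a1.conj_mem a ha _, rfl⟩
      intro g
      refine ⟨h3 t ht g, fun hg => ?_⟩
      have := h3 t⁻¹ (inv_mem ht) _ hg
      simpa [mul_assoc] using this
    rw [hN]
    refine Subgroup.mem_normalizer_iff.2 ?_
    intro g
    change g ∈ R ↔ _ ∈ R
    rw [h1, h1, h2]
    simp [mul_assoc]
  -- `P = V (P ∩ N)`
  have hPN' : (P : Subgroup G) ⊓ N = D := by
    apply hPN _ (P.2.to_le inf_le_left) inf_le_right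
    exact le_inf hDP (Subgroup.map_subtype_le _)
  apply hVP.not_ge
  intro g hg
  obtain ⟨v0, hv0, t0, ht0, e0⟩ := hm x
  obtain ⟨v, hv, t, ht, e⟩ := hm (g * x)
  have hk : (v * v0⁻¹)⁻¹ * g = x * (t0⁻¹ * t) * x⁻¹ := by
    have e1 : g = v * t * x⁻¹ := by rw [← e]; group
    rw [e1]
    nth_rw 2 [e0]
    group
  have hw : (v * v0⁻¹) ∈ V := mul_mem hv (inv_mem hv0)
  have hkD : (v * v0⁻¹)⁻¹ * g ∈ D := by
    rw [← hPN']
    refine Subgroup.mem_inf.2 ⟨mul_mem (inv_mem (hVP.le hw)) hg, ?_⟩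
    rw [hk]
    exact hTN _ (mul_mem (inv_mem ht0) ht)
  have := mul_mem hw (hDV hkD)
  rwa [mul_inv_cancel_left] at this

lemma exists_commuting_sylow [Finite G] {ι : Type*} {σ : ι → Set ℕ} (hσ : SigmaPartition σ)
    (h : Supp σ G) {j : ι} {p r : ℕ} (hp : p.Prime) (hr : r.Prime) (hpG : p ∣ Nat.card G)
    (hrG : r ∣ Nat.card G) (hrj : r ∈ σ j) (hpj : p ∉ σ j) (R : Sylow r G) :
    ∃ P : Sylow p G, ∀ x ∈ P, ∀ y ∈ R, Commute x y := by
  have := Fact.mk hp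
  have := Fact.mk hr
  have hpr : p ≠ r := fun e => hpj (e ▸ hrj)
  by_cases hall : ∀ q : ℕ, q.Prime → q ∣ Nat.card G → q = p ∨ q = r
  · obtain ⟨i, hi⟩ : ∃ i, p ∈ σ i := by
      rw [← Set.mem_iUnion, hσ.2.2]; exact hp
    have hri : r ∉ σ i := by
      intro hri
      by_cases e : i = j
      · exact hpj (e ▸ hi)
      · exact Set.disjoint_left.1 (hσ.2.1 e) hri hrj
    obtain ⟨P⟩ : Nonempty (Sylow p G) := inferInstance
    have n1 := two_primes hσ h hp hr hpG hrj hpj hall R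
    have n2 := two_primes hσ h hr hp hrG hi hri (fun q a b => (hall q a b).symm) P
    exact ⟨P, fun x hx y hy => Subgroup.commute_of_normal_of_disjoint _ _ n2 n1
      (IsPGroup.disjoint_of_ne _ _ hpr _ _ P.2 R.2) x y hx hy⟩
  · push Not at hall
    obtain ⟨q, hq, hqG, hqp, hqr⟩ := hall
    obtain ⟨T, hT, hTi⟩ := exists_T' h hq hqG
    obtain ⟨P', hP'⟩ := exists_sylow_le hp T (fun hh => hqp (hTi p hp hh).symm)
    obtain ⟨R', hR'⟩ := exists_sylow_le hr T (fun hh => hqr (hTi r hr hh).symm)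
    have key : ∀ x ∈ P', ∀ y ∈ R', Commute x y := by
      intro x hx y hy
      obtain ⟨a, ha⟩ := IsPGroup.iff_orderOf.1 P'.2 ⟨x, hx⟩
      obtain ⟨b, hb⟩ := IsPGroup.iff_orderOf.1 R'.2 ⟨y, hy⟩
      rw [Subgroup.orderOf_mk] at ha hb
      have := commute_of_sigmaNilpotent hσ hT hr hp hrj hpj
        (x := ⟨y, hR' hy⟩) (y := ⟨x, hP' hx⟩) (a := b) (b := a)
        (by rw [Subgroup.orderOf_mk, hb]) (by rw [Subgroup.orderOf_mk, ha])
      exact (congrArg Subtype.val this.eq).symm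
    obtain ⟨g, rfl⟩ := MulAction.exists_smul_eq G R' R
    refine ⟨g • P', ?_⟩
    rintro _ ⟨x, hx, rfl⟩ _ ⟨y, hy, rfl⟩
    exact (key x hx y hy).map (MulAut.conj g).toMonoidHom

/-- The normal Hall `σ j`-subgroup. -/
lemma exists_normal_hall [Finite G] {ι : Type*} {σ : ι → Set ℕ} (hσ : SigmaPartition σ)
    (h : Supp σ G) (j : ι) : ∃ N : Subgroup G, N.Normal ∧
      (∀ p : ℕ, p.Prime → p ∣ Nat.card N → p ∈ σ j) ∧
      (∀ p : ℕ, p.Prime → p ∈ σ j → ¬ p ∣ N.index) := by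
  obtain ⟨H, hH1, hH2⟩ : ∃ H : Subgroup G, (∀ p : ℕ, p.Prime → p ∣ Nat.card H → p ∈ σ j) ∧
      (∀ p : ℕ, p.Prime → p ∣ H.index → p ∉ σ j) := by
    by_cases hall : ∀ q : ℕ, q.Prime → q ∣ Nat.card G → q ∈ σ j
    · refine ⟨⊤, ?_, ?_⟩
      · rw [Subgroup.card_top]; exact hall
      · intro p hp hd
        rw [Subgroup.index_top] at hd
        exact absurd (Nat.dvd_one.1 hd) hp.ne_one
    · push Not at hall
      obtain ⟨q, hq, hqG, hqj⟩ := hall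
      obtain ⟨T, hT, hTi⟩ := exists_T' h hq hqG
      obtain ⟨A, B, a1, b1, hd, iA, iB, cA, cB⟩ := split hσ hT j
      refine ⟨A.map T.subtype, ?_, ?_⟩
      · intro p hp hh
        exact cA p hp (hh.trans (Subgroup.card_map_dvd _ _))
      · intro p hp hh
        rw [Subgroup.index_map_subtype, iA] at hh
        rcases hp.dvd_mul.1 hh with hh | hh
        · exact cB p hp hh
        · rw [hTi p hp hh]; exact hqj
  refine ⟨H.normalCore, inferInstance, fun p hp hd =>
    hH1 p hp (hd.trans (Subgroup.card_dvd_of_le H.normalCore_le)), ?_⟩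
  intro r hr hrj hri
  have := Fact.mk hr
  have hrG : r ∣ Nat.card G := hri.trans (Subgroup.index_dvd_card _)
  obtain ⟨R, hR⟩ := exists_sylow_le hr H (fun hh => hH2 r hr hh hrj)
  have hcop : (Subgroup.centralizer (R : Set G)).index.Coprime H.index := by
    apply Nat.coprime_of_dvd
    intro p hp h1 h2
    have := Fact.mk hp
    obtain ⟨P, hP⟩ := exists_commuting_sylow hσ h hp hr (h2.trans (Subgroup.index_dvd_card _))
      hrG hrj (hH2 p hp h2) R
    refine P.not_dvd_index (h1.trans (Subgroup.index_dvd_of_le ?_))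
    intro x hx
    rw [Subgroup.mem_centralizer_iff]
    intro y hy
    exact (hP x hx y hy).symm.eq
  have hle : (R : Subgroup G) ≤ H.normalCore := by
    intro y hy x
    obtain ⟨k, hk, c, hc, rfl⟩ := exists_mul_of_coprime_index hcop x
    have e := Subgroup.mem_centralizer_iff.1 hc y hy
    have e2 : k * c * y * (k * c)⁻¹ = k * y * k⁻¹ := by
      rw [mul_assoc k c y, ← e]; group
    rw [e2]
    exact mul_mem (mul_mem hk (hR hy)) (inv_mem hk)
  exact R.not_dvd_index (hri.trans (Subgroup.index_dvd_of_le hle))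

lemma sigmaNilpotent_of_supp [Finite G] {ι : Type*} {σ : ι → Set ℕ} (hσ : SigmaPartition σ)
    (h : Supp σ G) : SigmaNilpotent σ G := by
  classical
  choose N hN1 hN2 hN3 using exists_normal_hall hσ h
  have hcl : ∀ p : ℕ, p.Prime → ∃ i, p ∈ σ i := by
    intro p hp
    rw [← Set.mem_iUnion, hσ.2.2]; exact hp
  have hcls : ∀ p : {p // p ∈ (Nat.card G).primeFactors}, ∃ i, p.1 ∈ σ i :=
    fun p => hcl p.1 (Nat.prime_of_mem_primeFactors p.2)
  choose c hc using hcls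
  let s : Finset ι := Finset.univ.image c
  let e : Fin s.card ≃ s := s.equivFin.symm
  have hcop : ∀ i j, i ≠ j → (Nat.card (N i)).Coprime (Nat.card (N j)) := by
    intro i j hij
    apply Nat.coprime_of_dvd
    intro p hp h1 h2
    exact Set.disjoint_left.1 (hσ.2.1 hij) (hN2 i p hp h1) (hN2 j p hp h2)
  have hne : ∀ a b : Fin s.card, a ≠ b → (e a : ι) ≠ e b := fun a b hab hh =>
    hab (e.injective (Subtype.ext hh))
  refine ⟨s.card, fun k => N (e k), fun k => hN1 _, ?_, ?_, fun k => ⟨e k, hN2 _⟩⟩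
  · have := fun k => Fintype.ofFinite (N (e k))
    apply Subgroup.independent_of_coprime_order
    · intro a b hab x y hx hy
      exact Subgroup.commute_of_normal_of_disjoint _ _ (hN1 _) (hN1 _)
        (Subgroup.disjoint_of_coprime_natCard (hcop _ _ (hne a b hab))) x y hx hy
    · intro a b hab
      simp only [← Nat.card_eq_fintype_card]
      exact hcop _ _ (hne a b hab)
  · rw [← Subgroup.index_eq_one]
    by_contra h1
    obtain ⟨q, hq, hqd⟩ := Nat.exists_prime_and_dvd h1
    have hqG : q ∈ (Nat.card G).primeFactors :=
      Nat.mem_primeFactors.2 ⟨hq, hqd.trans (Subgroup.index_dvd_card _), Nat.card_pos.ne'⟩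
    have hmem : c ⟨q, hqG⟩ ∈ s := Finset.mem_image_of_mem _ (Finset.mem_univ _)
    refine hN3 (c ⟨q, hqG⟩) q hq (hc ⟨q, hqG⟩) (hqd.trans (Subgroup.index_dvd_of_le ?_))
    have := le_iSup (fun k => N (e k)) (e.symm ⟨_, hmem⟩)
    simpa using this

/-- `σ`-nilpotency transfers along the isomorphism `⊤ ≃* G`. -/
lemma sigmaNilpotent_top {ι : Type*} {σ : ι → Set ℕ} (h : SigmaNilpotent σ G) :
    SigmaNilpotent σ (⊤ : Subgroup G) := by
  obtain ⟨n, H, h1, h2, h3, h4⟩ := h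
  let f : G ≃* (⊤ : Subgroup G) := Subgroup.topEquiv.symm
  refine ⟨n, fun k => f.mapSubgroup (H k), ?_, ?_, ?_, ?_⟩
  · intro k
    exact (h1 k).map f.toMonoidHom f.surjective
  · exact h2.map_orderIso f.mapSubgroup
  · rw [← OrderIso.map_iSup, h3, OrderIso.map_top]
  · intro k
    obtain ⟨i, hi⟩ := h4 k
    refine ⟨i, fun p hp hd => hi p hp ?_⟩
    exact hd.trans (Subgroup.card_map_dvd (H := H k) f.toMonoidHom)

end SigmaAux

/-- A finite group `G` is `σ`-nilpotent if and only if every maximal subgroup of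
every Sylow subgroup of `G` has a `σ`-nilpotent supplement in `G`. -/
theorem sigma_nilpotent_iff_supplements {ι : Type*} (σ : ι → Set ℕ)
    (hσ : SigmaPartition σ) (G : Type*) [Group G] [Finite G] :
    SigmaNilpotent σ G ↔
      ∀ p : ℕ, p.Prime → p ∣ Nat.card G →
        ∀ (P : Sylow p G) (V : Subgroup G), V < ↑P →
          (∀ W : Subgroup G, V < W → W ≤ ↑P → W = ↑P) →
          ∃ T : Subgroup G, (V : Set G) * (T : Set G) = Set.univ ∧
            SigmaNilpotent σ ↥T := by
  constructor
  · intro h p _ _ P V _ _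
    refine ⟨⊤, ?_, SigmaAux.sigmaNilpotent_top h⟩
    rw [Set.eq_univ_iff_forall]
    intro g
    exact ⟨1, V.one_mem, g, trivial, one_mul g⟩
  · exact SigmaAux.sigmaNilpotent_of_supp hσ
end
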